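/- Up to equivalence, there is a unique binary self-dual [44,22,8] code having an automorphism of odd prime order whose weight enumerator is W_{44,2} with β = 154, i.e., with exactly 44 + 4·154 = 660 codewords of weight 8 and exactly 1232 − 8·154 = 0 codewords of weight 10; moreover, its automorphism group has order 786839961600 = 2^16 · 3^4 · 5^2 · 7^2 · 11^2. -/

import Mathlib

namespace SD

variable {ι : Type*}

/-- The (Hamming) weight of a binary vector. -/
def wt [Fintype ι] (v : ι → ZMod 2) : ℕ := (Finset.univ.filter fun i => v i ≠ 0).card

/-- A binary code (subspace of `F_2^ι`) is self-dual if it coincides with its dual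
under the standard inner product. -/
def isSelfDual [Fintype ι] (Code : Submodule (ZMod 2) (ι → ZMod 2)) : Prop :=
  ∀ u : ι → ZMod 2, u ∈ Code ↔ ∀ v ∈ Code, ∑ i, u i * v i = 0

/-- The linear map permuting coordinates of vectors by `σ`. -/
def permLM (σ : Equiv.Perm ι) : (ι → ZMod 2) →ₗ[ZMod 2] (ι → ZMod 2) where
  toFun v := v ∘ σ
  map_add' _ _ := rfl
  map_smul' _ _ := rfl

/-- The image of a code under a coordinate permutation. -/
def permCode (σ : Equiv.Perm ι) (Code : Submodule (ZMod 2) (ι → ZMod 2)) :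
    Submodule (ZMod 2) (ι → ZMod 2) := Submodule.map (permLM σ) Code

/-- Two binary codes are equivalent if a coordinate permutation maps one onto the other. -/
def codeEquiv (C D : Submodule (ZMod 2) (ι → ZMod 2)) : Prop :=
  ∃ σ : Equiv.Perm ι, permCode σ C = D

/-- The code has minimum weight (exactly) `d`. -/
def minWtEq [Fintype ι] (Code : Submodule (ZMod 2) (ι → ZMod 2)) (d : ℕ) : Prop :=
  (∀ v ∈ Code, v ≠ 0 → d ≤ wt v) ∧ ∃ v ∈ Code, v ≠ 0 ∧ wt v = d

/-- An automorphism of type `p-(c,f)` of a code of length `n`: order `p`, exactly `f`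
fixed points (hence exactly `c` independent `p`-cycles, as `n = p*c + f`). -/
def autOfType {n : ℕ} (σ : Equiv.Perm (Fin n)) (p c f : ℕ) : Prop :=
  orderOf σ = p ∧ (Finset.univ.filter fun i => σ i = i).card = f ∧ n = p * c + f

/-- A binary self-dual [44,22,8] code with an automorphism of odd prime order and
weight enumerator W_{44,2}, β = 154: exactly 660 codewords of weight 8 and 0 of weight 10. -/
def targetCode (Code : Submodule (ZMod 2) (Fin 44 → ZMod 2)) : Prop :=
  isSelfDual Code ∧ Module.finrank (ZMod 2) Code = 22 ∧ minWtEq Code 8 ∧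
  (∃ p : ℕ, p.Prime ∧ Odd p ∧
    ∃ σ : Equiv.Perm (Fin 44), permCode σ Code = Code ∧ orderOf σ = p) ∧
  Nat.card {v : Fin 44 → ZMod 2 // v ∈ Code ∧ wt v = 8} = 660 ∧
  Nat.card {v : Fin 44 → ZMod 2 // v ∈ Code ∧ wt v = 10} = 0

section Proof

open Finset Polynomial

section MacWilliams

lemma zmod_two_cases : ∀ a : ZMod 2, a = 0 ∨ a = 1 := by decide

/-- The sign character of `ZMod 2`. -/
def sgn (a : ZMod 2) : ℤ := if a = 0 then 1 else -1

lemma sgn_add : ∀ a b : ZMod 2, sgn (a + b) = sgn a * sgn b := by decide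

lemma sgn_sum {κ : Type*} (s : Finset κ) (f : κ → ZMod 2) :
    sgn (∑ i ∈ s, f i) = ∏ i ∈ s, sgn (f i) := by
  classical
  induction s using Finset.induction_on with
  | empty => simp [sgn]
  | insert a s ha ih => rw [sum_insert ha, prod_insert ha, sgn_add, ih]

lemma wt_le [Fintype ι] (v : ι → ZMod 2) : wt v ≤ Fintype.card ι := card_filter_le _ _

lemma prod_weight [Fintype ι] (c : ι → ZMod 2) (a b : ℤ[X]) :
    ∏ i, (if c i = 0 then a else b) = b ^ wt c * a ^ (Fintype.card ι - wt c) := by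
  classical
  rw [prod_ite, prod_const, prod_const, mul_comm]
  congr 2
  have := card_filter_add_card_filter_not (s := (univ : Finset ι)) (fun i => c i = 0)
  rw [card_univ] at this
  simp only [wt, ne_eq]
  lia

lemma sum_character [Fintype ι] [DecidableEq ι] (c : ι → ZMod 2) :
    ∑ v : ι → ZMod 2, Polynomial.C (sgn (∑ i, v i * c i)) * (X : ℤ[X]) ^ wt v =
      (1 - X) ^ wt c * (1 + X) ^ (Fintype.card ι - wt c) := by
  classical
  have h : ∀ v : ι → ZMod 2, Polynomial.C (sgn (∑ i, v i * c i)) * (X : ℤ[X]) ^ wt v =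
      ∏ i, (if v i = 0 then 1 else if c i = 0 then X else -X) := by
    intro v
    rw [sgn_sum, map_prod, wt, ← prod_const, prod_filter, ← prod_mul_distrib]
    refine prod_congr rfl fun i _ => ?_
    rcases zmod_two_cases (v i) with hv | hv <;> rcases zmod_two_cases (c i) with hc | hc <;>
      simp [sgn, hv, hc]
  rw [sum_congr rfl fun v _ => h v]
  have := Finset.prod_univ_sum (fun _ : ι => (univ : Finset (ZMod 2)))
    (fun i x => if x = 0 then (1 : ℤ[X]) else if c i = 0 then X else -X)
  rw [Fintype.piFinset_univ] at this
  rw [← this, ← prod_weight]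
  refine prod_congr rfl fun i _ => ?_
  have hu : (univ : Finset (ZMod 2)) = {0, 1} := rfl
  rw [hu, sum_pair (by decide)]
  split_ifs <;> simp_all [sub_eq_add_neg]

open Classical in
lemma sum_sgn_of_additive [Fintype ι] [DecidableEq ι] (C : Submodule (ZMod 2) (ι → ZMod 2))
    (q : (ι → ZMod 2) → ZMod 2) (hq : ∀ c ∈ C, ∀ d ∈ C, q (c + d) = q c + q d) :
    ∑ c with c ∈ C, sgn (q c) = if ∀ c ∈ C, q c = 0 then (Nat.card C : ℤ) else 0 := by
  split_ifs with h
  · rw [sum_congr rfl fun c hc => by rw [h c (mem_filter.1 hc).2]]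
    simp [sgn, Nat.card_eq_fintype_card, Fintype.card_subtype]
  · push Not at h
    obtain ⟨d, hd, hqd⟩ := h
    have hs : sgn (q d) = -1 := by simp [sgn, hqd]
    have key : ∑ c with c ∈ C, sgn (q c) = ∑ c with c ∈ C, -sgn (q c) := by
      refine sum_bij (fun c _ => c + d) ?_ (fun _ _ _ _ h => add_right_cancel h) ?_ ?_
      · simpa using fun c hc => C.add_mem hc hd
      · exact fun b hb => ⟨b - d, by simpa using C.sub_mem (by simpa using hb) hd, by simp⟩
      · intro c hc
        rw [hq c (by simpa using hc) d hd, sgn_add, hs]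
        ring
    rw [sum_neg_distrib] at key
    lia

open Classical in
/-- The MacWilliams identity for a code twisted by an additive function `q`. -/
theorem macWilliams [Fintype ι] [DecidableEq ι] (C : Submodule (ZMod 2) (ι → ZMod 2))
    (q : (ι → ZMod 2) → ZMod 2) (hq : ∀ c ∈ C, ∀ d ∈ C, q (c + d) = q c + q d) :
    ∑ c with c ∈ C, Polynomial.C (sgn (q c)) *
        ((1 - X) ^ wt c * (1 + X) ^ (Fintype.card ι - wt c)) =
      Polynomial.C (Nat.card C : ℤ) *
        ∑ v with ∀ c ∈ C, ∑ i, v i * c i = q c, (X : ℤ[X]) ^ wt v := by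
  simp_rw [← sum_character, mul_sum]
  rw [sum_comm, sum_filter]
  refine sum_congr rfl fun v _ => ?_
  have := sum_sgn_of_additive C (fun c => q c + ∑ i, v i * c i) (fun c hc d hd => by
    simp only [hq c hc d hd, Pi.add_apply, mul_add, sum_add_distrib]
    ring)
  have h2 : (∀ c ∈ C, q c + ∑ i, v i * c i = 0) ↔ ∀ c ∈ C, ∑ i, v i * c i = q c :=
    forall₂_congr fun c _ => by rw [CharTwo.add_eq_zero, eq_comm]
  simp only [h2, sgn_add] at this
  simp_rw [← mul_assoc, ← map_mul, ← sum_mul, ← map_sum, this]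
  split_ifs <;> simp

/-- The binary Krawtchouk polynomial of degree `j` for length `n`, at `w`. -/
def krawtchouk (n j w : ℕ) : ℤ :=
  ∑ s ∈ range (j + 1), (-1) ^ s * w.choose s * ((n - w).choose (j - s) : ℕ)

lemma coeff_one_sub_X_pow (n s : ℕ) : ((1 - X : ℤ[X]) ^ n).coeff s = (-1) ^ s * n.choose s := by
  have h : (1 - X : ℤ[X]) ^ n = ((1 + X) ^ n).comp (Polynomial.C (-1) * X) := by
    simp [sub_eq_add_neg]
  rw [h, comp_C_mul_X_coeff, coeff_one_add_X_pow, mul_comm]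

lemma coeff_krawtchouk (n j w : ℕ) :
    ((1 - X : ℤ[X]) ^ w * (1 + X) ^ (n - w)).coeff j = krawtchouk n j w := by
  rw [coeff_mul, Nat.sum_antidiagonal_eq_sum_range_succ_mk, krawtchouk]
  exact sum_congr rfl fun s _ => by rw [coeff_one_sub_X_pow, coeff_one_add_X_pow]

open Classical in
/-- The number of codewords of weight `w`. -/
noncomputable def weightCount [Fintype ι] [DecidableEq ι] (C : Set (ι → ZMod 2)) (w : ℕ) : ℕ :=
  #{c | c ∈ C ∧ wt c = w}

/-- The twisted MacWilliams identity in terms of weight distributions. -/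
theorem macWilliams_weightCount {n : ℕ} (C : Submodule (ZMod 2) (Fin n → ZMod 2)) (g : ℕ → ZMod 2)
    (hg : ∀ c ∈ C, ∀ d ∈ C, g (wt (c + d)) = g (wt c) + g (wt d)) (j : ℕ) :
    ∑ w ∈ range (n + 1), weightCount (C : Set (Fin n → ZMod 2)) w * (sgn (g w) * krawtchouk n j w) =
      Nat.card C * weightCount {v | ∀ c ∈ C, ∑ i, v i * c i = g (wt c)} j := by
  classical
  have h := congrArg (coeff · j) (macWilliams C (fun c => g (wt c)) hg)
  simp only [Fintype.card_fin, finsetSum_coeff, coeff_C_mul, coeff_krawtchouk, coeff_X_pow] at h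
  rw [sum_boole, filter_filter] at h
  rw [weightCount]
  simp only [Set.mem_ofPred_eq]
  convert h using 1
  · rw [← sum_fiberwise_of_maps_to (t := range (n + 1)) (g := wt) (fun c _ => by
      have := wt_le c
      rw [Fintype.card_fin] at this
      simpa using Nat.lt_succ_of_le this)]
    refine sum_congr rfl fun w _ => ?_
    rw [filter_filter, sum_congr rfl (g := fun _ => sgn (g w) * krawtchouk n j w)
      fun c hc => by rw [(mem_filter.1 hc).2.2]]
    simp [weightCount]
  · simp only [eq_comm (a := j)]

end MacWilliams

section SelfDual

/-- The support of a binary vector. -/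
def supp [Fintype ι] (v : ι → ZMod 2) : Finset ι := univ.filter fun i => v i ≠ 0

lemma card_supp [Fintype ι] (v : ι → ZMod 2) : #(supp v) = wt v := rfl

lemma mem_supp [Fintype ι] {v : ι → ZMod 2} {i : ι} : i ∈ supp v ↔ v i ≠ 0 := by simp [supp]

lemma supp_injective [Fintype ι] : Function.Injective (supp : (ι → ZMod 2) → Finset ι) := by
  intro u v h
  funext i
  have := Finset.ext_iff.1 h i
  rw [mem_supp, mem_supp] at this
  rcases zmod_two_cases (u i) with hu | hu <;> rcases zmod_two_cases (v i) with hv | hv <;>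
    simp_all

lemma dot_eq_card [Fintype ι] [DecidableEq ι] (u v : ι → ZMod 2) :
    ∑ i, u i * v i = (#(supp u ∩ supp v) : ZMod 2) := by
  rw [card_eq_sum_ones, Nat.cast_sum, ← sum_subset (subset_univ (supp u ∩ supp v))]
  · refine sum_congr rfl fun i hi => ?_
    rw [mem_inter, mem_supp, mem_supp] at hi
    rcases zmod_two_cases (u i) with hu | hu <;> rcases zmod_two_cases (v i) with hv | hv <;>
      simp_all
  · intro i _ hi
    rw [mem_inter, mem_supp, mem_supp] at hi
    rcases zmod_two_cases (u i) with hu | hu <;> rcases zmod_two_cases (v i) with hv | hv <;>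
      simp_all

lemma wt_add [Fintype ι] [DecidableEq ι] (u v : ι → ZMod 2) :
    wt (u + v) + 2 * #(supp u ∩ supp v) = wt u + wt v := by
  have h : supp (u + v) = (supp u ∪ supp v) \ (supp u ∩ supp v) := by
    ext i
    simp only [mem_supp, mem_sdiff, mem_union, mem_inter, Pi.add_apply]
    rcases zmod_two_cases (u i) with hu | hu <;> rcases zmod_two_cases (v i) with hv | hv <;>
      simp [hu, hv, CharTwo.add_self_eq_zero]
  have h1 := card_union_add_card_inter (supp u) (supp v)
  have h2 := card_sdiff_of_subset (inter_subset_union (s := supp u) (t := supp v))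
  rw [← h, card_supp] at h2
  rw [card_supp, card_supp] at h1
  have := card_le_card (inter_subset_union (s := supp u) (t := supp v))
  lia

lemma wt_pos [Fintype ι] {v : ι → ZMod 2} (h : v ≠ 0) : 0 < wt v := by
  rw [← card_supp, card_pos]
  by_contra hn
  refine h (funext fun i => ?_)
  by_contra hi
  exact hn ⟨i, mem_supp.2 hi⟩

lemma wt_zero [Fintype ι] : wt (0 : ι → ZMod 2) = 0 := by simp [wt]

variable [Fintype ι] [DecidableEq ι] {C : Submodule (ZMod 2) (ι → ZMod 2)}

lemma isSelfDual.even_inter (hC : isSelfDual C) {c d : ι → ZMod 2} (hc : c ∈ C) (hd : d ∈ C) :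
    Even #(supp c ∩ supp d) := by
  rw [← ZMod.natCast_eq_zero_iff_even, ← dot_eq_card]
  exact (hC c).1 hc d hd

lemma isSelfDual.even_wt (hC : isSelfDual C) {c : ι → ZMod 2} (hc : c ∈ C) : Even (wt c) := by
  simpa [card_supp] using hC.even_inter hc hc

lemma isSelfDual.one_mem (hC : isSelfDual C) : (1 : ι → ZMod 2) ∈ C := by
  refine (hC 1).2 fun v hv => ?_
  have h : supp (1 : ι → ZMod 2) ∩ supp v = supp v := by ext; simp [mem_supp]
  rw [dot_eq_card, h, card_supp, ZMod.natCast_eq_zero_iff_even]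
  exact hC.even_wt hv

lemma isSelfDual.half_wt_add (hC : isSelfDual C) {c d : ι → ZMod 2} (hc : c ∈ C) (hd : d ∈ C) :
    ((wt (c + d) / 2 : ℕ) : ZMod 2) = (wt c / 2 : ℕ) + (wt d / 2 : ℕ) := by
  obtain ⟨k, hk⟩ := hC.even_inter hc hd
  obtain ⟨a, ha⟩ := hC.even_wt hc
  obtain ⟨b, hb⟩ := hC.even_wt hd
  have h := wt_add c d
  rw [← Nat.cast_add, ZMod.natCast_eq_natCast_iff, Nat.ModEq]
  lia

/-- The shadow of a self-dual code. -/
def shadow (C : Submodule (ZMod 2) (ι → ZMod 2)) : Set (ι → ZMod 2) :=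
  {v | ∀ c ∈ C, ∑ i, v i * c i = ((wt c / 2 : ℕ) : ZMod 2)}

omit [DecidableEq ι] in
lemma isSelfDual.add_mem_of_mem_shadow (hC : isSelfDual C) {u v : ι → ZMod 2}
    (hu : u ∈ shadow C) (hv : v ∈ shadow C) : u + v ∈ C := by
  refine (hC _).2 fun c hc => ?_
  simp only [Pi.add_apply, add_mul, sum_add_distrib]
  rw [hu c hc, hv c hc, CharTwo.add_self_eq_zero]

lemma isSelfDual.weightCount_odd (hC : isSelfDual C) {w : ℕ} (hw : Odd w) :
    weightCount (C : Set (ι → ZMod 2)) w = 0 := by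
  classical
  rw [weightCount, card_eq_zero, filter_eq_empty_iff]
  rintro c - ⟨hc, rfl⟩
  exact Nat.not_even_iff_odd.2 hw (hC.even_wt hc)

lemma isSelfDual.weightCount_compl (hC : isSelfDual C) {w : ℕ} (hw : w ≤ Fintype.card ι) :
    weightCount (C : Set (ι → ZMod 2)) (Fintype.card ι - w) = weightCount (C : Set (ι → ZMod 2)) w := by
  have key : ∀ c : ι → ZMod 2, wt (1 + c) = Fintype.card ι - wt c := by
    intro c
    have h := wt_add 1 c
    have h1 : supp (1 : ι → ZMod 2) ∩ supp c = supp c := by ext; simp [mem_supp]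
    have h2 : wt (1 : ι → ZMod 2) = Fintype.card ι := by simp [wt]
    rw [h1, card_supp, h2] at h
    lia
  have h1 : ∀ c : ι → ZMod 2, 1 + (1 + c) = c := fun c => by
    funext i
    simp only [Pi.add_apply, ← add_assoc, CharTwo.add_self_eq_zero, zero_add]
  refine card_nbij' (1 + ·) (1 + ·) ?_ ?_ (fun c _ => h1 c) (fun c _ => h1 c)
  · intro c hc
    simp only [coe_filter, mem_univ, true_and, SetLike.mem_coe, Set.mem_ofPred_eq] at hc ⊢
    refine ⟨C.add_mem hC.one_mem hc.1, ?_⟩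
    rw [key, hc.2]
    lia
  · intro c hc
    simp only [coe_filter, mem_univ, true_and, SetLike.mem_coe, Set.mem_ofPred_eq] at hc ⊢
    exact ⟨C.add_mem hC.one_mem hc.1, by rw [key, hc.2]⟩

lemma weightCount_zero : weightCount (C : Set (ι → ZMod 2)) 0 = 1 := by
  rw [weightCount, card_eq_one]
  refine ⟨0, ?_⟩
  ext c
  simp only [mem_filter, mem_univ, true_and, SetLike.mem_coe, mem_singleton]
  refine ⟨fun h => ?_, fun h => by rw [h]; exact ⟨C.zero_mem, wt_zero⟩⟩
  by_contra hc
  exact (wt_pos hc).ne' h.2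

end SelfDual

section Length44

variable {C : Submodule (ZMod 2) (Fin 44 → ZMod 2)}

lemma card_code (hk : Module.finrank (ZMod 2) C = 22) : Nat.card C = 2 ^ 22 := by
  rw [Module.natCard_eq_pow_finrank (K := ZMod 2), hk, Nat.card_zmod]

/-- Weights of a self-dual code of length 44 come in complementary even pairs. -/
lemma isSelfDual.sum_weightCount (hC : isSelfDual C)
    (h2 : weightCount (C : Set (Fin 44 → ZMod 2)) 2 = 0)
    (h4 : weightCount (C : Set (Fin 44 → ZMod 2)) 4 = 0)
    (h6 : weightCount (C : Set (Fin 44 → ZMod 2)) 6 = 0)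
    (h10 : weightCount (C : Set (Fin 44 → ZMod 2)) 10 = 0) (f : ℕ → ℤ) :
    ∑ w ∈ range 45, weightCount (C : Set (Fin 44 → ZMod 2)) w * f w =
      (f 0 + f 44) + weightCount (C : Set (Fin 44 → ZMod 2)) 8 * (f 8 + f 36) +
      weightCount (C : Set (Fin 44 → ZMod 2)) 12 * (f 12 + f 32) +
      weightCount (C : Set (Fin 44 → ZMod 2)) 14 * (f 14 + f 30) +
      weightCount (C : Set (Fin 44 → ZMod 2)) 16 * (f 16 + f 28) +
      weightCount (C : Set (Fin 44 → ZMod 2)) 18 * (f 18 + f 26) +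
      weightCount (C : Set (Fin 44 → ZMod 2)) 20 * (f 20 + f 24) +
      weightCount (C : Set (Fin 44 → ZMod 2)) 22 * f 22 := by
  have ho : ∀ k, weightCount (C : Set (Fin 44 → ZMod 2)) (2 * k + 1) = 0 :=
    fun k => hC.weightCount_odd ⟨k, rfl⟩
  have hc : ∀ w, w ≤ 44 → weightCount (C : Set (Fin 44 → ZMod 2)) (44 - w) =
      weightCount (C : Set (Fin 44 → ZMod 2)) w := fun w hw => by
    simpa using hC.weightCount_compl (w := w) (by simpa using hw)
  have h0 := weightCount_zero (C := C)
  rw [range_eq_Ico, sum_Ico_succ_top (by norm_num)]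
  have hsum : ∀ g : ℕ → ℤ, ∑ w ∈ Ico 0 44, g w =
      ∑ k ∈ range 22, (g (2 * k) + g (2 * k + 1)) := fun g => by
    simp only [Finset.sum_range_succ, Finset.sum_range_zero, ← range_eq_Ico]
    ring
  rw [hsum]
  simp only [ho, Nat.cast_zero, zero_mul, add_zero, Finset.sum_range_succ, Finset.sum_range_zero,
    Nat.reduceMul, zero_add]
  rw [← hc 24 (by norm_num), ← hc 26 (by norm_num), ← hc 28 (by norm_num), ← hc 30 (by norm_num),
    ← hc 32 (by norm_num), ← hc 34 (by norm_num), ← hc 36 (by norm_num), ← hc 38 (by norm_num),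
    ← hc 40 (by norm_num), ← hc 42 (by norm_num), ← hc 44 (by norm_num)]
  norm_num only [h0, h2, h4, h6, h10]
  ring

lemma krawtchouk_eq : krawtchouk = fun n j w => ∑ s ∈ range (j + 1), (-1) ^ s *
    ((w.descFactorial s / s.factorial : ℕ) : ℤ) *
      ((n - w).descFactorial (j - s) / (j - s).factorial : ℕ) := by
  funext n j w
  simp only [krawtchouk, Nat.choose_eq_descFactorial_div_factorial]

lemma krawtchouk_values :
    ([0, 2, 4, 6, 8, 10].map fun j =>
      [0, 8, 12, 14, 16, 18, 20, 22, 24, 26, 28, 30, 32, 36, 44].map (krawtchouk 44 j)) =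
    [[1, 1, 1, 1, 1, 1, 1, 1, 1, 1, 1, 1, 1, 1, 1],
     [946, 370, 178, 106, 50, 10, -14, -22, -14, 10, 50, 106, 178, 370, 946],
     [135751, 17479, 2631, 231, -441, -281, 71, 231, 71, -281, -441, 231, 2631, 17479, 135751],
     [7059052, 223468, -7060, -6916, 364, 2236, -20, -1540, -20, 2236, 364, -6916, -7060, 223468, 7059052],
     [177232627, 646387, -60685, 23699, 9971, -9581, -1805, 7315, -1805, -9581, 9971, 23699, -60685, 646387, 177232627],
     [2481256778, -2313206, 258634, 12194, -58422, 24258, 12426, -26334, 12426, 24258, -58422, 12194, 258634, -2313206, 2481256778]] := by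
  rw [krawtchouk_eq]
  decide +kernel

lemma isSelfDual.shadow_weightCount (hC : isSelfDual C) (hk : Module.finrank (ZMod 2) C = 22)
    (h2 : weightCount (C : Set (Fin 44 → ZMod 2)) 2 = 0)
    (h4 : weightCount (C : Set (Fin 44 → ZMod 2)) 4 = 0)
    (h6 : weightCount (C : Set (Fin 44 → ZMod 2)) 6 = 0)
    (h10 : weightCount (C : Set (Fin 44 → ZMod 2)) 10 = 0) :
    (weightCount (C : Set (Fin 44 → ZMod 2)) 8 : ℤ) + 128 * weightCount (shadow C) 2 = 660 ∧
    (weightCount (shadow C) 6 : ℤ) + 42 * weightCount (shadow C) 2 = 154 := by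
  have hd : {v | ∀ c ∈ C, ∑ i, v i * c i = 0} = (C : Set (Fin 44 → ZMod 2)) := by
    ext v
    exact (hC v).symm
  have e := macWilliams_weightCount C (fun _ => 0) (by simp)
  have s := macWilliams_weightCount C (fun w => ((w / 2 : ℕ) : ZMod 2))
    fun c hc d hd => hC.half_wt_add hc hd
  change ∀ j, _ = _ * (weightCount (shadow C) j : ℤ) at s
  simp only [hC.sum_weightCount h2 h4 h6 h10, hd, card_code hk] at e s
  have e0 := e 0
  have e2 := e 2
  have e4 := e 4
  have e6 := e 6
  have e8 := e 8
  have e10 := e 10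
  have s2 := s 2
  have s6 := s 6
  have hs : ∀ k, sgn ((k : ℕ) : ZMod 2) = (-1) ^ k := fun k => by
    rcases Nat.even_or_odd k with h | h
    · rw [(ZMod.natCast_eq_zero_iff_even).2 h, h.neg_one_pow]; rfl
    · rw [(ZMod.natCast_eq_one_iff_odd).2 h, h.neg_one_pow]; rfl
  have hs0 : sgn 0 = 1 := rfl
  simp only [weightCount_zero, h2, h4, h6, h10, hs, hs0] at e0 e2 e4 e6 e8 e10 s2 s6
  clear e s hs hs0 hd h2 h4 h6 h10 hk hC
  have hK := krawtchouk_values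
  simp only [List.map_cons, List.map_nil, List.cons.injEq, and_true] at hK
  simp only [hK, Nat.reduceDiv, Nat.reducePow, Nat.cast_ofNat, Nat.cast_zero, Nat.cast_one,
    Int.reducePow, Int.reduceNeg] at e0 e2 e4 e6 e8 e10 s2 s6
  constructor <;> linarith

end Length44

section Sextets

variable {α : Type*} [DecidableEq α]

/-- Six-element sets any two of which are disjoint or meet in two points. -/
structure SextetSystem (H : Finset (Finset α)) : Prop where
  card_eq : ∀ B ∈ H, #B = 6
  inter : ∀ B ∈ H, ∀ B' ∈ H, B ≠ B' → #(B ∩ B') = 0 ∨ #(B ∩ B') = 2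

/-- The blocks of `H` through `p`. -/
def blocks (H : Finset (Finset α)) (p : α) : Finset (Finset α) := {B ∈ H | p ∈ B}

lemma mem_blocks {H : Finset (Finset α)} {p : α} {B : Finset α} :
    B ∈ blocks H p ↔ B ∈ H ∧ p ∈ B := by simp [blocks]

lemma sum_card_inter_eq (s : Finset α) (H : Finset (Finset α)) :
    ∑ B ∈ H, #(s ∩ B) = ∑ a ∈ s, #(blocks H a) := by
  simp_rw [← filter_mem_eq_inter]
  exact (sum_card_bipartiteAbove_eq_sum_card_bipartiteBelow (fun a B => a ∈ B)).symm

namespace SextetSystem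

variable {H : Finset (Finset α)}

lemma eq_of_three_mem (hH : SextetSystem H) {B B' : Finset α} (hB : B ∈ H) (hB' : B' ∈ H)
    {a b c : α} (hab : a ≠ b) (hac : a ≠ c) (hbc : b ≠ c) (ha : a ∈ B) (hb : b ∈ B) (hc : c ∈ B)
    (ha' : a ∈ B') (hb' : b ∈ B') (hc' : c ∈ B') : B = B' := by
  by_contra h
  have h3 : 2 < #(B ∩ B') :=
    two_lt_card.2 ⟨a, by simp [*], b, by simp [*], c, by simp [*], hab, hac, hbc⟩
  have := hH.inter B hB B' hB' h
  omega

lemma card_erase_inter (hH : SextetSystem H) {B B' : Finset α} (hB : B ∈ H) (hB' : B' ∈ H)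
    (h : B ≠ B') {p : α} (hp : p ∈ B) (hp' : p ∈ B') : #(B.erase p ∩ B') = 1 := by
  have hm : p ∈ B ∩ B' := mem_inter.2 ⟨hp, hp'⟩
  have h0 := card_pos.2 ⟨p, hm⟩
  have := hH.inter B hB B' hB' h
  rw [erase_inter, card_erase_of_mem hm]
  omega

lemma card_biUnion_blocks (hH : SextetSystem H) {p x : α} (hx : x ≠ p) {S : Finset (Finset α)}
    (hS : S ⊆ blocks (blocks H p) x) :
    #(S.biUnion fun B => (B.erase p).erase x) = 4 * #S := by
  have hm : ∀ B ∈ S, B ∈ H ∧ p ∈ B ∧ x ∈ B := fun B hB => by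
    have := hS hB
    simp only [mem_blocks] at this
    tauto
  rw [card_biUnion, sum_const_nat (m := 4), mul_comm]
  · intro B hB
    obtain ⟨h1, h2, h3⟩ := hm B hB
    rw [card_erase_of_mem (mem_erase.2 ⟨hx, h3⟩), card_erase_of_mem h2, hH.card_eq B h1]
  · intro B hB B' hB' hne
    refine disjoint_left.2 fun c hc hc' => hne ?_
    obtain ⟨h1, h2, h3⟩ := hm B hB
    obtain ⟨h1', h2', h3'⟩ := hm B' hB'
    simp only [mem_erase] at hc hc'
    exact hH.eq_of_three_mem h1 h1' hx.symm (Ne.symm hc.2.1) (Ne.symm hc.1) h2 h3 hc.2.2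
      h2' h3' hc'.2.2

lemma codegree_le (hH : SextetSystem H) {p x : α} (hx : x ≠ p) {B₀ : Finset α} (hB₀ : B₀ ∈ H)
    (hp : p ∈ B₀) (hxB : x ∉ B₀) : #(blocks (blocks H p) x) ≤ 5 := by
  have h1 : ∑ B ∈ blocks (blocks H p) x, #(B₀.erase p ∩ B) = #(blocks (blocks H p) x) * 1 :=
    sum_const_nat fun B hB => by
      simp only [mem_blocks] at hB
      exact hH.card_erase_inter hB₀ hB.1.1 (fun h => hxB (h ▸ hB.2)) hp hB.1.2
  have h2 : ∑ B ∈ blocks (blocks H p) x, #(B₀.erase p ∩ B) ≤ #(B₀.erase p) * 1 := by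
    refine sum_card_inter_le fun a ha => card_le_one.2 fun B hB B' hB' => ?_
    simp only [mem_filter, mem_blocks, mem_erase] at ha hB hB'
    have : a ≠ x := fun h => hxB (h ▸ ha.2)
    exact hH.eq_of_three_mem hB.1.1.1 hB'.1.1.1 hx.symm (Ne.symm ha.1) this.symm hB.1.1.2 hB.1.2 hB.2
      hB'.1.1.2 hB'.1.2 hB'.2
  rw [card_erase_of_mem hp, hH.card_eq B₀ hB₀] at h2
  omega

lemma sum_codegree (hH : SextetSystem H) {p : α} {B₀ : Finset α} (hB₀ : B₀ ∈ H) (hp : p ∈ B₀) :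
    ∑ b ∈ B₀.erase p, #(blocks (blocks H p) b) = #(blocks H p) + 4 := by
  have hm : B₀ ∈ blocks H p := mem_blocks.2 ⟨hB₀, hp⟩
  rw [← sum_card_inter_eq, ← add_sum_erase _ _ hm, inter_eq_left.2 (erase_subset _ _),
    card_erase_of_mem hp, hH.card_eq B₀ hB₀, sum_const_nat (m := 1), card_erase_of_mem hm]
  · have := card_pos.2 ⟨_, hm⟩
    omega
  · intro B hB
    simp only [mem_erase, mem_blocks] at hB
    exact hH.card_erase_inter hB₀ hB.2.1 (Ne.symm hB.1) hp hB.2.2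

variable [Fintype α]

lemma degree_cases (hH : SextetSystem H) (hα : Fintype.card α = 44) (p : α) :
    #(blocks H p) ≤ 10 ∨ ∀ x ≠ p, #(blocks (blocks H p) x) ≤ 5 := by
  refine or_iff_not_imp_right.2 fun h => ?_
  push Not at h
  obtain ⟨x, hx, h⟩ := h
  have hall : blocks (blocks H p) x = blocks H p := by
    refine filter_true_of_mem fun B hB => ?_
    by_contra hxB
    rw [mem_blocks] at hB
    have := hH.codegree_le hx hB.1 hB.2 hxB
    omega
  have h1 := hH.card_biUnion_blocks hx hall.ge
  have h2 : #((blocks H p).biUnion fun B => (B.erase p).erase x) ≤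
      #((univ.erase p).erase x) := by
    refine card_le_card (biUnion_subset.2 fun B _ c hc => ?_)
    simp only [mem_erase, mem_univ, and_true] at hc ⊢
    tauto
  rw [card_erase_of_mem (by simp [hx]), card_erase_of_mem (mem_univ _), card_univ, hα] at h2
  omega

lemma degree_le (hH : SextetSystem H) (hα : Fintype.card α = 44) (p : α) :
    #(blocks H p) ≤ 21 := by
  rcases hH.degree_cases hα p with h | h
  · omega
  · rcases (blocks H p).eq_empty_or_nonempty with h0 | ⟨B₀, hB₀⟩
    · simp [h0]
    · rw [mem_blocks] at hB₀
      have h1 := hH.sum_codegree hB₀.1 hB₀.2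
      have h2 := sum_le_card_nsmul (B₀.erase p) (fun b => #(blocks (blocks H p) b)) 5
        fun b hb => h b (ne_of_mem_erase hb)
      rw [card_erase_of_mem hB₀.2, hH.card_eq B₀ hB₀.1, smul_eq_mul] at h2
      omega

lemma degree_eq (hH : SextetSystem H) (hα : Fintype.card α = 44) (hc : #H = 154) (p : α) :
    #(blocks H p) = 21 := by
  have h1 : ∑ p : α, #(blocks H p) = ∑ p : α, 21 := by
    rw [← sum_card_inter_eq, sum_const, card_univ, hα, sum_const_nat (m := 6), hc,
      smul_eq_mul]
    intro B hB
    rw [univ_inter, hH.card_eq B hB]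
  exact (sum_eq_sum_iff_of_le fun p _ => hH.degree_le hα p).1 h1 p (mem_univ p)

lemma codegree_eq (hH : SextetSystem H) (hα : Fintype.card α = 44) (hc : #H = 154) {p x : α}
    (hx : x ≠ p) {B₀ : Finset α} (hB₀ : B₀ ∈ H) (hp : p ∈ B₀) (hxB : x ∈ B₀) :
    #(blocks (blocks H p) x) = 5 := by
  have hd := hH.degree_eq hα hc p
  have h := (hH.degree_cases hα p).resolve_left (by omega)
  have h1 := hH.sum_codegree hB₀ hp
  have h2 : ∑ b ∈ B₀.erase p, #(blocks (blocks H p) b) = ∑ b ∈ B₀.erase p, 5 := by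
    rw [h1, hd, sum_const, card_erase_of_mem hp, hH.card_eq B₀ hB₀, smul_eq_mul]
  exact (sum_eq_sum_iff_of_le fun b hb => h b (ne_of_mem_erase hb)).1 h2 x
    (mem_erase.2 ⟨hx, hxB⟩)

end SextetSystem

/-- The union of the blocks of `H` through `p`. -/
def cluster (H : Finset (Finset α)) (p : α) : Finset α := (blocks H p).biUnion id

lemma mem_cluster {H : Finset (Finset α)} {p x : α} :
    x ∈ cluster H p ↔ ∃ B ∈ H, p ∈ B ∧ x ∈ B := by
  simp [cluster, mem_blocks, and_assoc]

lemma mem_cluster_comm {H : Finset (Finset α)} {p x : α} :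
    x ∈ cluster H p ↔ p ∈ cluster H x := by
  simp only [mem_cluster, and_comm]

namespace SextetSystem

variable {H : Finset (Finset α)} [Fintype α]

lemma self_mem_cluster (hH : SextetSystem H) (hα : Fintype.card α = 44) (hc : #H = 154) (p : α) :
    p ∈ cluster H p := by
  have h : 0 < #(blocks H p) := by
    rw [hH.degree_eq hα hc]
    norm_num
  obtain ⟨B, hB⟩ := card_pos.1 h
  rw [mem_blocks] at hB
  exact mem_cluster.2 ⟨B, hB.1, hB.2, hB.2⟩

lemma card_cluster (hH : SextetSystem H) (hα : Fintype.card α = 44) (hc : #H = 154) (p : α) :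
    #(cluster H p) = 22 := by
  have h1 := sum_card_inter_eq ((cluster H p).erase p) (blocks H p)
  have hs : p ∈ cluster H p := hH.self_mem_cluster hα hc p
  rw [sum_const_nat (m := 5), sum_const_nat (m := 5), hH.degree_eq hα hc,
    card_erase_of_mem hs] at h1
  · omega
  · intro x hx
    obtain ⟨hxp, hx⟩ := mem_erase.1 hx
    obtain ⟨B, hB, hp, hxB⟩ := mem_cluster.1 hx
    exact hH.codegree_eq hα hc hxp hB hp hxB
  · intro B hB
    rw [erase_inter, inter_eq_right.2 (show B ⊆ cluster H p from subset_biUnion_of_mem id hB)]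
    rw [mem_blocks] at hB
    rw [card_erase_of_mem hB.2, hH.card_eq B hB.1]

lemma cluster_eq_of_mem (hH : SextetSystem H) (hα : Fintype.card α = 44) (hc : #H = 154)
    {a b : α} (hab : b ≠ a) (hb : b ∈ cluster H a) :
    (blocks (blocks H a) b).biUnion id = cluster H a := by
  obtain ⟨B, hB, haB, hbB⟩ := mem_cluster.1 hb
  have h5 := hH.codegree_eq hα hc hab hB haB hbB
  have h20 := hH.card_biUnion_blocks hab (Subset.refl (blocks (blocks H a) b))
  have hsub : insert a (insert b
      ((blocks (blocks H a) b).biUnion fun B => (B.erase a).erase b)) ⊆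
      (blocks (blocks H a) b).biUnion id := by
    have hm : B ∈ blocks (blocks H a) b := mem_blocks.2 ⟨mem_blocks.2 ⟨hB, haB⟩, hbB⟩
    refine insert_subset (mem_biUnion.2 ⟨B, hm, haB⟩)
      (insert_subset (mem_biUnion.2 ⟨B, hm, hbB⟩) (biUnion_mono fun B _ => ?_))
    exact (erase_subset _ _).trans (erase_subset _ _)
  have hle := card_le_card hsub
  rw [card_insert_of_notMem (by simp [Ne.symm hab]), card_insert_of_notMem (by simp), h20, h5]
    at hle
  exact eq_of_subset_of_card_le (biUnion_subset_biUnion_of_subset_left _ (filter_subset _ _))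
    (by rw [hH.card_cluster hα hc]; exact hle)

lemma cluster_eq (hH : SextetSystem H) (hα : Fintype.card α = 44) (hc : #H = 154)
    {a b : α} (hb : b ∈ cluster H a) : cluster H b = cluster H a := by
  rcases eq_or_ne b a with rfl | hab
  · rfl
  rw [← hH.cluster_eq_of_mem hα hc hab hb,
    ← hH.cluster_eq_of_mem hα hc hab.symm (mem_cluster_comm.1 hb)]
  congr 1
  ext B
  simp only [mem_blocks]
  tauto

lemma exists_block (hH : SextetSystem H) (hα : Fintype.card α = 44) (hc : #H = 154)
    {a b c : α} (hab : b ≠ a) (hb : b ∈ cluster H a) (hx : c ∈ cluster H a) :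
    ∃ B ∈ H, a ∈ B ∧ b ∈ B ∧ c ∈ B := by
  rw [← hH.cluster_eq_of_mem hα hc hab hb] at hx
  simp only [mem_biUnion, mem_blocks, id] at hx
  obtain ⟨B, hB, hc⟩ := hx
  exact ⟨B, hB.1.1, hB.1.2, hB.2, hc⟩

end SextetSystem

/-- A Steiner system `S(3, 6, 22)` with point set `K` and block set `H`. -/
structure Steiner (K : Finset α) (H : Finset (Finset α)) : Prop extends SextetSystem H where
  card_points : #K = 22
  card_blocks : #H = 77
  subset : ∀ B ∈ H, B ⊆ K
  exists_block : ∀ a ∈ K, ∀ b ∈ K, ∀ c ∈ K, a ≠ b → ∃ B ∈ H, a ∈ B ∧ b ∈ B ∧ c ∈ B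

lemma SextetSystem.steiner_cluster {H : Finset (Finset α)} [Fintype α] (hH : SextetSystem H)
    (hα : Fintype.card α = 44) (hc : #H = 154) (p : α) :
    Steiner (cluster H p) {B ∈ H | B ⊆ cluster H p} where
  card_eq B hB := hH.card_eq B (filter_subset _ _ hB)
  inter B hB B' hB' := hH.inter B (filter_subset _ _ hB) B' (filter_subset _ _ hB')
  card_points := hH.card_cluster hα hc p
  subset B hB := (mem_filter.1 hB).2
  card_blocks := by
    have h1 := sum_card_inter_eq (cluster H p) {B ∈ H | B ⊆ cluster H p}
    rw [sum_const_nat (m := 6), sum_const_nat (m := 21), hH.card_cluster hα hc] at h1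
    · omega
    · intro x hx
      rw [← hH.degree_eq hα hc x]
      congr 1
      ext B
      simp only [mem_blocks, mem_filter, and_congr_left_iff, and_iff_left_iff_imp]
      intro hxB hB
      rw [← hH.cluster_eq hα hc hx]
      exact subset_biUnion_of_mem id (mem_blocks.2 ⟨hB, hxB⟩)
    · intro B hB
      rw [inter_eq_right.2 (mem_filter.1 hB).2, hH.card_eq B (filter_subset _ _ hB)]
  exists_block a ha b hb c hx hab := by
    rw [← hH.cluster_eq hα hc ha] at hb hx ⊢
    obtain ⟨B, hB, h⟩ := hH.exists_block hα hc hab.symm hb hx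
    exact ⟨B, mem_filter.2 ⟨hB, subset_biUnion_of_mem id (mem_blocks.2 ⟨hB, h.1⟩)⟩, h⟩

lemma SextetSystem.exists_steiner {H : Finset (Finset α)} [Fintype α] (hH : SextetSystem H)
    (hα : Fintype.card α = 44) (hc : #H = 154) :
    ∃ K : Finset α, Steiner K {B ∈ H | B ⊆ K} ∧ Steiner Kᶜ {B ∈ H | B ⊆ Kᶜ} ∧
      ∀ B ∈ H, B ⊆ K ∨ B ⊆ Kᶜ := by
  have : Nonempty α := Fintype.card_pos_iff.1 (by omega)
  obtain ⟨p⟩ := this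
  have hcard : #(cluster H p)ᶜ = 22 := by rw [card_compl, hα, hH.card_cluster hα hc]
  have hcompl : ∀ q ∉ cluster H p, cluster H q = (cluster H p)ᶜ := fun q hq => by
    refine eq_of_subset_of_card_le (fun x hx => mem_compl.2 fun hx' => hq ?_) ?_
    · rw [← hH.cluster_eq hα hc hx', hH.cluster_eq hα hc hx]
      exact hH.self_mem_cluster hα hc q
    · rw [hcard, hH.card_cluster hα hc]
  obtain ⟨q, hq⟩ := card_pos.1 (by omega : 0 < #(cluster H p)ᶜ)
  rw [mem_compl] at hq
  refine ⟨cluster H p, hH.steiner_cluster hα hc p, ?_, fun B hB => ?_⟩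
  · rw [← hcompl q hq]
    exact hH.steiner_cluster hα hc q
  · obtain ⟨x, hx⟩ := card_pos.1 (by rw [hH.card_eq B hB]; norm_num : 0 < #B)
    have hs : B ⊆ cluster H x := subset_biUnion_of_mem id (mem_blocks.2 ⟨hB, hx⟩)
    by_cases h : x ∈ cluster H p
    · exact Or.inl (hH.cluster_eq hα hc h ▸ hs)
    · exact Or.inr (hcompl x h ▸ hs)

end Sextets

section Labellings

/-- The fifteen fixed-point-free involutions of six points. -/
def syntheme : Fin 15 → Fin 6 → Fin 6 :=
  ![![1,0,3,2,5,4], ![1,0,4,5,2,3], ![1,0,5,4,3,2], ![2,3,0,1,5,4], ![2,4,0,5,1,3],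
    ![2,5,0,4,3,1], ![3,2,1,0,5,4], ![3,4,5,0,1,2], ![3,5,4,0,2,1], ![4,2,1,5,0,3],
    ![4,3,5,1,0,2], ![4,5,3,2,0,1], ![5,2,1,4,3,0], ![5,3,4,1,2,0], ![5,4,3,2,1,0]]

lemma syntheme_ne : ∀ j a, syntheme j a ≠ a := by decide

set_option synthInstance.maxHeartbeats 400000 in
set_option synthInstance.maxSize 1000 in
lemma exists_syntheme_aux : ∀ p0 : Fin 6, p0 ≠ 0 → ∀ p1 : Fin 6, p1 ≠ 1 → (p0 = 1 ↔ p1 = 0) →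
    ∀ p2 : Fin 6, p2 ≠ 2 → (p0 = 2 ↔ p2 = 0) → (p1 = 2 ↔ p2 = 1) →
    ∀ p3 : Fin 6, p3 ≠ 3 → (p0 = 3 ↔ p3 = 0) → (p1 = 3 ↔ p3 = 1) → (p2 = 3 ↔ p3 = 2) →
    ∀ p4 : Fin 6, p4 ≠ 4 → (p0 = 4 ↔ p4 = 0) → (p1 = 4 ↔ p4 = 1) → (p2 = 4 ↔ p4 = 2) →
      (p3 = 4 ↔ p4 = 3) →
    ∀ p5 : Fin 6, p5 ≠ 5 → (p0 = 5 ↔ p5 = 0) → (p1 = 5 ↔ p5 = 1) → (p2 = 5 ↔ p5 = 2) →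
      (p3 = 5 ↔ p5 = 3) → (p4 = 5 ↔ p5 = 4) →
    ∃ j, ![p0, p1, p2, p3, p4, p5] = syntheme j := by
  decide +kernel

lemma exists_syntheme {π : Fin 6 → Fin 6} (h1 : ∀ a, π a ≠ a) (h2 : ∀ a b, π a = b ↔ π b = a) :
    ∃ j, π = syntheme j := by
  obtain ⟨j, hj⟩ := exists_syntheme_aux (π 0) (h1 0) (π 1) (h1 1) (h2 0 1) (π 2) (h1 2) (h2 0 2)
    (h2 1 2) (π 3) (h1 3) (h2 0 3) (h2 1 3) (h2 2 3) (π 4) (h1 4) (h2 0 4) (h2 1 4) (h2 2 4)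
    (h2 3 4) (π 5) (h1 5) (h2 0 5) (h2 1 5) (h2 2 5) (h2 3 5) (h2 4 5)
  refine ⟨j, ?_⟩
  rw [← hj]
  ext a
  fin_cases a <;> rfl

/-- The `j`-th point outside the base hexad and the base point. -/
def synPt (j : Fin 15) : Fin 22 := Fin.natAdd 6 (Fin.natAdd 1 j)

/-- The `a`-th point of the base hexad. -/
def hexPt (a : Fin 6) : Fin 22 := Fin.castAdd 16 a

/-- The base hexad. -/
def baseHexad : Finset (Fin 22) := univ.image hexPt

/-- The hexad meeting the base hexad in a given pair and containing the base point. -/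
def pairHexad (a b : Fin 6) : Finset (Fin 22) :=
  {hexPt a, hexPt b, 6} ∪ (univ.filter fun j => syntheme j a = b).image synPt

lemma point_cases : ∀ i : Fin 22, (∃ a, i = hexPt a) ∨ i = 6 ∨ ∃ j, i = synPt j := by decide

lemma card_pairHexad : ∀ a b, a ≠ b → #(pairHexad a b) = 6 := by decide +kernel

lemma exists_syntheme_apply : ∀ a b, a ≠ b → ∃ j, syntheme j a = b := by decide

variable {α : Type*} [DecidableEq α] {K : Finset α} {H : Finset (Finset α)}

/-- Injective labellings of points by the 22 standard points that carry the sixteen standard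
hexads to blocks. -/
structure Labelling (H : Finset (Finset α)) (f : Fin 22 → α) : Prop where
  injective : Function.Injective f
  base_mem : baseHexad.image f ∈ H
  pair_mem : ∀ a b, a ≠ b → (pairHexad a b).image f ∈ H

lemma labelling_congr {f : Fin 22 → α} {H' : Finset (Finset α)} (h : H ⊆ H')
    (hf : Labelling H f) : Labelling H' f :=
  ⟨hf.injective, h hf.base_mem, fun a b hab => h (hf.pair_mem a b hab)⟩

/-- `y` is joined with the base point `o` and both members of each pair of the `j`-th syntheme. -/
def HasType (H : Finset (Finset α)) (e : Fin 6 → α) (o : α) (j : Fin 15) (y : α) : Prop :=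
  ∀ a, ∃ B ∈ H, e a ∈ B ∧ e (syntheme j a) ∈ B ∧ o ∈ B ∧ y ∈ B

lemma Labelling.hasType {f : Fin 22 → α} (hf : Labelling H f) (j : Fin 15) :
    HasType H (f ∘ hexPt) (f 6) j (f (synPt j)) := fun a =>
  ⟨_, hf.pair_mem a (syntheme j a) (syntheme_ne j a).symm,
    mem_image_of_mem _ (by simp [pairHexad]), mem_image_of_mem _ (by simp [pairHexad]),
    mem_image_of_mem _ (by simp [pairHexad]),
    mem_image_of_mem _ (mem_union_right _ (mem_image_of_mem _ (by simp)))⟩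

namespace Steiner

variable {e : Fin 6 → α} {o : α}

lemma eq_of_hasType (hS : Steiner K H) (he : Function.Injective e) (hb : univ.image e ∈ H)
    (ho : o ∉ univ.image e) {j : Fin 15} {y y' : α} (hy : y ≠ o) (hy' : y' ≠ o)
    (h : HasType H e o j y) (h' : HasType H e o j y') : y = y' := by
  by_contra hne
  have hmem : ∀ a, e a ∈ univ.image e := fun a => mem_image_of_mem _ (mem_univ a)
  have key : ∀ a, ∃ B ∈ H, e a ∈ B ∧ e (syntheme j a) ∈ B ∧ o ∈ B ∧ y ∈ B ∧ y' ∈ B := fun a => by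
    obtain ⟨B, hB, h1, h2, h3, h4⟩ := h a
    obtain ⟨B', hB', h1', h2', h3', h4'⟩ := h' a
    have : B = B' := hS.eq_of_three_mem (c := o) hB hB' (he.ne (syntheme_ne j a).symm)
      (fun h => ho (h ▸ hmem a)) (fun h => ho (h ▸ hmem _)) h1 h2 h3 h1' h2' h3'
    exact ⟨B, hB, h1, h2, h3, h4, this ▸ h4'⟩
  have hc : ∀ j, ∃ c, c ≠ 0 ∧ c ≠ syntheme j 0 := by decide
  obtain ⟨c, hc0, hc1⟩ := hc j
  obtain ⟨B, hB, h1, h2, h3, h4, h5⟩ := key 0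
  obtain ⟨B', hB', h1', -, h3', h4', h5'⟩ := key c
  have hBB : B = B' := hS.eq_of_three_mem hB hB' hy hne hy'.symm h4 h3 h5 h4' h3' h5'
  have : B = univ.image e := hS.eq_of_three_mem hB hb (he.ne (syntheme_ne j 0).symm)
    (he.ne hc0.symm) (he.ne hc1.symm) h1 h2 (hBB ▸ h1') (hmem _) (hmem _) (hmem _)
  exact ho (this ▸ h3)

lemma exists_hasType (hS : Steiner K H) (he : Function.Injective e) (hb : univ.image e ∈ H)
    (ho : o ∉ univ.image e) (hoK : o ∈ K) {y : α} (hy : y ≠ o) (hyK : y ∈ K)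
    (hye : y ∉ univ.image e) : ∃ j, HasType H e o j y := by
  have hmem : ∀ a, e a ∈ univ.image e := fun a => mem_image_of_mem _ (mem_univ a)
  have hblock : ∀ a, ∃ B ∈ H, o ∈ B ∧ y ∈ B ∧ e a ∈ B := fun a =>
    hS.exists_block o hoK y hyK (e a) (hS.subset _ hb (hmem a)) hy.symm
  have huniq : ∀ a B, B ∈ H → o ∈ B → y ∈ B → e a ∈ B → ∀ B', B' ∈ H → o ∈ B' → y ∈ B' →
      e a ∈ B' → B = B' := fun a B hB h1 h2 h3 B' hB' h1' h2' h3' =>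
    hS.eq_of_three_mem hB hB' hy.symm (fun h => ho (h ▸ hmem a)) (fun h => hye (h ▸ hmem a))
      h1 h2 h3 h1' h2' h3'
  have hother : ∀ a, ∃ b, b ≠ a ∧ ∃ B ∈ H, o ∈ B ∧ y ∈ B ∧ e a ∈ B ∧ e b ∈ B := fun a => by
    obtain ⟨B, hB, h1, h2, h3⟩ := hblock a
    have hne : univ.image e ≠ B := fun h => ho (h ▸ h1)
    have h := hS.card_erase_inter hb hB hne (hmem a) h3
    obtain ⟨x, hx⟩ := card_pos.1 (by omega : 0 < #((univ.image e).erase (e a) ∩ B))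
    simp only [mem_inter, mem_erase, mem_image, mem_univ, true_and] at hx
    obtain ⟨⟨hxa, b, rfl⟩, hxB⟩ := hx
    exact ⟨b, fun h => hxa (h ▸ rfl), B, hB, h1, h2, h3, hxB⟩
  choose π hπ B hB hoB hyB haB hbB using hother
  have hsymm : ∀ a, π (π a) = a := fun a => by
    by_contra hne
    have h1 : B a = B (π a) :=
      huniq (π a) _ (hB a) (hoB a) (hyB a) (hbB a) _ (hB _) (hoB _) (hyB _) (haB _)
    have h2 : B a = univ.image e := hS.eq_of_three_mem (hB a) hb (he.ne (hπ a))
      (he.ne (hπ (π a)).symm) (he.ne (Ne.symm hne)) (hbB a) (haB a) (h1 ▸ hbB (π a)) (hmem _)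
      (hmem _) (hmem _)
    exact ho (h2 ▸ hoB a)
  obtain ⟨j, rfl⟩ := exists_syntheme hπ fun a b =>
    ⟨fun h => h ▸ hsymm a, fun h => h ▸ hsymm b⟩
  exact ⟨j, fun a => ⟨B a, hB a, haB a, hbB a, hoB a, hyB a⟩⟩

lemma exists_points (hS : Steiner K H) (he : Function.Injective e) (hb : univ.image e ∈ H)
    (ho : o ∉ univ.image e) (hoK : o ∈ K) :
    ∃ q : Fin 15 → α, ∀ j, q j ∈ K ∧ q j ≠ o ∧ q j ∉ univ.image e ∧ HasType H e o j (q j) := by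
  set Y := (K \ univ.image e).erase o with hY
  have hYm : ∀ {y}, y ∈ Y ↔ y ≠ o ∧ y ∈ K ∧ y ∉ univ.image e := by
    intro y
    rw [hY, mem_erase, mem_sdiff]
  have hYc : #Y = 15 := by
    rw [hY, card_erase_of_mem (mem_sdiff.2 ⟨hoK, ho⟩), card_sdiff_of_subset (hS.subset _ hb),
      hS.card_points, hS.card_eq _ hb]
  have hex : ∀ y : Y, ∃ j, HasType H e o j y := fun y => by
    obtain ⟨h1, h2, h3⟩ := hYm.1 y.2
    exact hS.exists_hasType he hb ho hoK h1 h2 h3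
  choose t ht using hex
  have htinj : Function.Injective t := fun y y' h => Subtype.ext <|
    hS.eq_of_hasType he hb ho (hYm.1 y.2).1 (hYm.1 y'.2).1 (ht y) (h ▸ ht y')
  have htb : Function.Bijective t :=
    (Fintype.bijective_iff_injective_and_card t).2 ⟨htinj, by simp [hYc]⟩
  choose q hq using htb.2
  refine ⟨fun j => q j, fun j => ?_⟩
  obtain ⟨h1, h2, h3⟩ := hYm.1 (q j).2
  exact ⟨h2, h1, h3, by simpa only [hq] using ht (q j)⟩

lemma exists_labelling (hS : Steiner K H) (he : Function.Injective e) (hb : univ.image e ∈ H)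
    (ho : o ∉ univ.image e) (hoK : o ∈ K) :
    ∃ f : Fin 22 → α, Labelling H f ∧ f ∘ hexPt = e ∧ f 6 = o := by
  have hmem : ∀ a, e a ∈ univ.image e := fun a => mem_image_of_mem _ (mem_univ a)
  obtain ⟨q, hq⟩ := hS.exists_points he hb ho hoK
  let f : Fin 22 → α := Fin.append e (Fin.append (fun _ : Fin 1 => o) q)
  have hf1 : ∀ a, f (hexPt a) = e a := fun a => Fin.append_left e _ a
  have hf2 : f 6 = o :=
    (Fin.append_right e (Fin.append (fun _ : Fin 1 => o) q) 0).trans (Fin.append_left _ q 0)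
  have hf3 : ∀ j, f (synPt j) = q j := fun j =>
    (Fin.append_right e (Fin.append (fun _ : Fin 1 => o) q) (Fin.natAdd 1 j)).trans
      (Fin.append_right _ q j)
  have hqinj : Function.Injective q := fun j j' h => by
    obtain ⟨B, hB, h1, h2, h3, h4⟩ := (hq j).2.2.2 0
    by_contra hne
    have hc : ∀ j j', j ≠ j' → ∃ a, syntheme j a ≠ syntheme j' a := by decide
    obtain ⟨a, ha⟩ := hc j j' hne
    obtain ⟨B, hB, h1, h2, h3, h4⟩ := (hq j).2.2.2 a
    obtain ⟨B', hB', h1', h2', h3', h4'⟩ := (hq j').2.2.2 a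
    have hBB : B = B' := hS.eq_of_three_mem hB hB' (hq j).2.1
      (fun h => (hq j).2.2.1 (h ▸ hmem a)) (fun h => ho (h ▸ hmem a)) h4 h3 h1
      (h ▸ h4') h3' h1'
    have : B = univ.image e := hS.eq_of_three_mem hB hb (he.ne ha)
      (he.ne (syntheme_ne j a)) (he.ne (syntheme_ne j' a)) h2 (hBB ▸ h2') h1 (hmem _) (hmem _)
      (hmem _)
    exact ho (this ▸ h3)
  have hinj : Function.Injective f := by
    intro i i' h
    have hq0 : ∀ j a, q j ≠ e a := fun j a h => (hq j).2.2.1 (h ▸ hmem a)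
    have ho0 : ∀ a, o ≠ e a := fun a h => ho (h ▸ hmem a)
    rcases point_cases i with ⟨a, rfl⟩ | rfl | ⟨j, rfl⟩ <;>
    rcases point_cases i' with ⟨a', rfl⟩ | rfl | ⟨j', rfl⟩ <;>
    simp only [hf1, hf2, hf3] at h
    · rw [he h]
    · exact absurd h.symm (ho0 _)
    · exact absurd h.symm (hq0 _ _)
    · exact absurd h (ho0 _)
    · rfl
    · exact absurd h.symm (hq _).2.1
    · exact absurd h (hq0 _ _)
    · exact absurd h (hq _).2.1
    · rw [hqinj h]
  refine ⟨f, ⟨hinj, ?_, fun a b hab => ?_⟩, funext hf1, hf2⟩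
  · have : baseHexad.image f = univ.image e := by
      rw [baseHexad, image_image]
      congr 1
      exact funext hf1
    rwa [this]
  · obtain ⟨j, rfl⟩ := exists_syntheme_apply a b hab
    obtain ⟨B, hB, h1, h2, h3, h4⟩ := (hq j).2.2.2 a
    have hsub : (pairHexad a (syntheme j a)).image f ⊆ B := by
      intro x hx
      simp only [pairHexad, mem_image, mem_union, mem_insert, mem_singleton, mem_filter, mem_univ,
        true_and] at hx
      obtain ⟨i, (rfl | rfl | rfl) | ⟨j', hj', rfl⟩, rfl⟩ := hx
      · rwa [hf1]
      · rwa [hf1]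
      · rwa [hf2]
      · rw [hf3]
        obtain ⟨B', hB', h1', h2', h3', h4'⟩ := (hq j').2.2.2 a
        rw [hj'] at h2'
        have : B = B' := hS.eq_of_three_mem (c := o) hB hB' (he.ne (syntheme_ne j a).symm)
          (fun h => ho (h ▸ hmem a)) (fun h => ho (h ▸ hmem _)) h1 h2 h3 h1' h2' h3'
        exact this ▸ h4'
    rwa [eq_of_subset_of_card_le hsub (by
      rw [hS.card_eq B hB, card_image_of_injective _ hinj, card_pairHexad _ _ hab])]

lemma labelling_ext (hS : Steiner K H) {f f' : Fin 22 → α} (hf : Labelling H f)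
    (hf' : Labelling H f') (he : f ∘ hexPt = f' ∘ hexPt) (ho : f 6 = f' 6) : f = f' := by
  have hb : univ.image (f ∘ hexPt) ∈ H := by
    rw [← image_image]
    exact hf.base_mem
  have h6 : ∀ a, hexPt a ≠ 6 := by decide
  have h7 : ∀ j, synPt j ≠ 6 := by decide
  have ho' : f 6 ∉ univ.image (f ∘ hexPt) := by
    simp only [mem_image, mem_univ, true_and, not_exists, Function.comp]
    exact fun a h => h6 a (hf.injective h)
  funext i
  rcases point_cases i with ⟨a, rfl⟩ | rfl | ⟨j, rfl⟩
  · exact congrFun he a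
  · exact ho
  · refine hS.eq_of_hasType (hf.injective.comp (by decide : Function.Injective hexPt)) hb ho'
      (hf.injective.ne (h7 j)) ?_ (hf.hasType j) ?_
    · rw [ho]
      exact hf'.injective.ne (h7 j)
    · rw [he, ho]
      exact hf'.hasType j

lemma labelling_base (hS : Steiner K H) {f : Fin 22 → α} (hf : Labelling H f) :
    univ.image (f ∘ hexPt) ∈ H ∧ f 6 ∈ K \ univ.image (f ∘ hexPt) := by
  have h6 : ∀ a, hexPt a ≠ 6 := by decide
  refine ⟨by rw [← image_image]; exact hf.base_mem, mem_sdiff.2 ⟨?_, ?_⟩⟩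
  · exact hS.subset _ (hf.pair_mem 0 1 (by decide))
      (mem_image_of_mem _ (by simp [pairHexad]))
  · simp only [mem_image, mem_univ, true_and, not_exists, Function.comp]
    exact fun a h => h6 a (hf.injective h)

end Steiner

lemma card_embedding_map_eq [Fintype α] {n : ℕ} {B : Finset α} (hB : #B = n) :
    #{e : Fin n ↪ α | univ.map e = B} = n.factorial := by
  have : Fintype.card (Fin n ↪ B) = n.factorial := by
    rw [Fintype.card_embedding_eq, Fintype.card_coe, hB, Fintype.card_fin, Nat.descFactorial_self]
  rw [← this, ← card_univ]
  refine (card_bij (fun e _ => e.trans (Function.Embedding.subtype _)) ?_ ?_ ?_).symm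
  · intro e _
    refine mem_filter.2 ⟨mem_univ _, eq_of_subset_of_card_le (fun x hx => ?_) (by simp [hB])⟩
    simp only [mem_map, mem_univ, true_and] at hx
    obtain ⟨i, rfl⟩ := hx
    exact (e i).2
  · intro e _ e' _ h
    ext i
    exact DFunLike.congr_fun h i
  · intro e he
    rw [mem_filter] at he
    have hm : ∀ i, e i ∈ B := fun i => he.2 ▸ mem_map_of_mem _ (mem_univ i)
    exact ⟨e.codRestrict B hm, mem_univ _, by ext; rfl⟩

namespace Steiner

lemma card_labelling [Fintype α] (hS : Steiner K H) :
    Nat.card {f : Fin 22 → α // Labelling H f} = 887040 := by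
  let T : Finset ((Fin 6 ↪ α) × α) := {p | univ.map p.1 ∈ H ∧ p.2 ∈ K \ univ.map p.1}
  have hT : #T = 887040 := by
    have hE : #{e : Fin 6 ↪ α | univ.map e ∈ H} = 77 * 720 := by
      rw [card_eq_sum_card_fiberwise (f := fun e => univ.map e) (t := H) fun e he => by
        simpa using he, ← hS.card_blocks]
      refine sum_const_nat fun B hB => ?_
      rw [filter_filter, ← show (6).factorial = 720 from rfl,
        ← card_embedding_map_eq (hS.card_eq B hB)]
      congr 1
      ext e
      simp only [mem_filter, mem_univ, true_and]
      exact ⟨fun h => h.2, fun h => ⟨h ▸ hB, h⟩⟩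
    rw [card_eq_sum_card_fiberwise (f := Prod.fst)
      (t := ({e : Fin 6 ↪ α | univ.map e ∈ H} : Finset (Fin 6 ↪ α))) fun p hp => by
        simp only [T, coe_filter, mem_univ, true_and, Set.mem_ofPred_eq] at hp ⊢
        exact hp.1]
    rw [sum_const_nat (m := 16), hE]
    intro e he
    simp only [mem_filter, mem_univ, true_and] at he
    have : (T.filter fun p => p.1 = e) = (K \ univ.map e).map (Function.Embedding.sectR e α) := by
      ext ⟨e', o⟩
      simp only [T, mem_filter, mem_univ, true_and, mem_map, Function.Embedding.sectR_apply,
        Prod.mk.injEq]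
      constructor
      · rintro ⟨⟨-, h⟩, rfl⟩
        exact ⟨o, h, rfl, rfl⟩
      · rintro ⟨o, h, rfl, rfl⟩
        exact ⟨⟨he, h⟩, rfl⟩
    rw [this, card_map, card_sdiff_of_subset (hS.subset _ he), hS.card_points, hS.card_eq _ he]
  rw [← hT, ← Fintype.card_coe, ← Nat.card_eq_fintype_card]
  have hmap : ∀ e : Fin 6 ↪ α, univ.map e = univ.image e := fun e => map_eq_image e univ
  refine Nat.card_congr (Equiv.ofBijective (fun f => ⟨(⟨f.1 ∘ hexPt,
    f.2.injective.comp (by decide : Function.Injective hexPt)⟩, f.1 6), ?_⟩) ⟨?_, ?_⟩)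
  · simp only [T, mem_filter, mem_univ, true_and, hmap]
    exact hS.labelling_base f.2
  · intro f f' h
    simp only [Subtype.mk.injEq, Prod.mk.injEq, Function.Embedding.mk.injEq] at h
    exact Subtype.ext (hS.labelling_ext f.2 f'.2 h.1 h.2)
  · rintro ⟨⟨e, o⟩, hp⟩
    simp only [T, mem_filter, mem_univ, true_and, hmap, mem_sdiff] at hp
    obtain ⟨f, hf, rfl', rfl⟩ := hS.exists_labelling e.injective hp.1 hp.2.2 hp.2.1
    exact ⟨⟨f, hf⟩, Subtype.ext (Prod.ext (DFunLike.coe_injective rfl') rfl)⟩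

end Steiner

end Labellings

section StandardCode

/-- The binary vector of length `n` given by the binary digits of `m`. -/
def bits (n m : ℕ) : Fin n → ZMod 2 := fun i => if m.testBit i then 1 else 0

/-- The number of ones among the last `n` binary digits of `m`. -/
def popcount : ℕ → ℕ → ℕ
  | 0, _ => 0
  | n + 1, m => m % 2 + popcount n (m / 2)

lemma card_testBit (n m : ℕ) : #{i : Fin n | m.testBit i} = popcount n m := by
  induction n generalizing m with
  | zero => rfl
  | succ n ih =>
    rw [card_filter, Fin.sum_univ_succ, popcount, ← ih, card_filter]
    congr 1
    · rcases Nat.mod_two_eq_zero_or_one m with h | h <;> simp [Nat.testBit_zero, h]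
    · simp [Nat.testBit_succ]

lemma wt_bits (n m : ℕ) : wt (bits n m) = popcount n m := by
  rw [← card_testBit, wt]
  congr 1
  ext i
  simp [bits]

lemma bits_xor (n a b : ℕ) : bits n (a ^^^ b) = bits n a + bits n b := by
  funext i
  simp only [bits, Nat.testBit_xor, Pi.add_apply]
  cases a.testBit i <;> cases b.testBit i <;> rfl

lemma dot_bits (n a b : ℕ) : ∑ i, bits n a i * bits n b i = (popcount n (a &&& b) : ZMod 2) := by
  rw [← card_testBit, card_filter, Nat.cast_sum]
  refine sum_congr rfl fun i _ => ?_
  simp only [bits, Nat.testBit_and]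
  cases a.testBit i <;> cases b.testBit i <;> rfl

/-- The embedding of the first 22 coordinates. -/
def left : Fin 22 → Fin 44 := Fin.castAdd 22

/-- The embedding of the last 22 coordinates. -/
def right : Fin 22 → Fin 44 := Fin.natAdd 22

lemma left_injective : Function.Injective left := Fin.castAdd_injective 22 22

lemma right_injective : Function.Injective right := Fin.natAdd_injective 22 22

lemma left_ne_right (i j : Fin 22) : left i ≠ right j := fun h => by
  have := congrArg Fin.val h
  simp only [left, right, Fin.val_castAdd, Fin.val_natAdd] at this
  omega

lemma half_cases (i : Fin 44) : (∃ j, i = left j) ∨ ∃ j, i = right j :=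
  Fin.addCases (m := 22) (n := 22) (motive := fun i => (∃ j, i = left j) ∨ ∃ j, i = right j)
    (fun j => Or.inl ⟨j, rfl⟩) (fun j => Or.inr ⟨j, rfl⟩) i

lemma sum_halves {M : Type*} [AddCommMonoid M] (f : Fin 44 → M) :
    ∑ i, f i = ∑ i, f (left i) + ∑ i, f (right i) :=
  @Fin.sum_univ_add M _ 22 22 f

/-- The vector of length 44 whose halves are given by binary digits. -/
def vec (p : ℕ × ℕ) : Fin 44 → ZMod 2 := Fin.append (bits 22 p.1) (bits 22 p.2)

lemma vec_left (p : ℕ × ℕ) (i : Fin 22) : vec p (left i) = bits 22 p.1 i :=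
  Fin.append_left (bits 22 p.1) (bits 22 p.2) i

lemma vec_right (p : ℕ × ℕ) (i : Fin 22) : vec p (right i) = bits 22 p.2 i :=
  Fin.append_right (bits 22 p.1) (bits 22 p.2) i

lemma vec_xor (a b c d : ℕ) : vec (a ^^^ b, c ^^^ d) = vec (a, c) + vec (b, d) := by
  funext i
  rcases half_cases i with ⟨j, rfl⟩ | ⟨j, rfl⟩ <;>
    simp only [vec_left, vec_right, bits_xor, Pi.add_apply]

lemma vec_zero : vec (0, 0) = 0 := by
  have := vec_xor 0 0 0 0
  simpa using this

lemma wt_vec (p : ℕ × ℕ) : wt (vec p) = popcount 22 p.1 + popcount 22 p.2 := by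
  rw [← wt_bits, ← wt_bits]
  simp only [wt, card_filter]
  rw [sum_halves]
  simp only [vec_left, vec_right]

lemma dot_vec (p q : ℕ × ℕ) : ∑ i, vec p i * vec q i =
    ((popcount 22 (p.1 &&& q.1) + popcount 22 (p.2 &&& q.2) : ℕ) : ZMod 2) := by
  rw [sum_halves, Nat.cast_add, ← dot_bits, ← dot_bits]
  simp only [vec_left, vec_right]

/-- All sums of sublists of a list of binary words. -/
def sums : List ℕ → List ℕ
  | [] => [0]
  | d :: l => sums l ++ (sums l).map (d ^^^ ·)

lemma exists_sums {V : Type*} [AddCommGroup V] [Module (ZMod 2) V] {φ : ℕ → V} (h0 : φ 0 = 0)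
    (hφ : ∀ a b, φ (a ^^^ b) = φ a + φ b) (l : List ℕ) {x : V}
    (hx : x ∈ Submodule.span (ZMod 2) (φ '' {m | m ∈ l})) : ∃ m ∈ sums l, x = φ m := by
  induction l generalizing x with
  | nil => simpa [sums, h0] using hx
  | cons d l ih =>
    have : {m | m ∈ d :: l} = insert d {m | m ∈ l} := by ext; simp
    rw [this, Set.image_insert_eq, Submodule.mem_span_insert] at hx
    obtain ⟨a, z, hz, rfl⟩ := hx
    obtain ⟨m, hm, rfl⟩ := ih hz
    rcases zmod_two_cases a with rfl | rfl
    · exact ⟨m, List.mem_append_left _ hm, by simp⟩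
    · exact ⟨d ^^^ m, List.mem_append_right _ (List.mem_map_of_mem hm), by simp [hφ]⟩

lemma isSelfDual_span_of_dual {g w : Fin 22 → Fin 44 → ZMod 2}
    (hg : ∀ i j, ∑ k, g i k * g j k = 0) (hw : ∀ i j, ∑ k, g i k * w j k = if i = j then 1 else 0) :
    isSelfDual (Submodule.span (ZMod 2) (Set.range g)) ∧
      Module.finrank (ZMod 2) (Submodule.span (ZMod 2) (Set.range g)) = 22 := by
  set S := Submodule.span (ZMod 2) (Set.range g)
  have hli : LinearIndependent (ZMod 2) g := by
    rw [Fintype.linearIndependent_iff]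
    intro c hc j
    have h : ∑ k, (∑ i, c i • g i) k * w j k = c j := by
      simp only [Finset.sum_apply, Pi.smul_apply, smul_eq_mul, sum_mul, mul_assoc]
      rw [sum_comm]
      simp [← mul_sum, hw]
    rw [← h, hc]
    simp
  have hrank : Module.finrank (ZMod 2) S = 22 := by
    rw [finrank_span_eq_card hli, Fintype.card_fin]
  let B : LinearMap.BilinForm (ZMod 2) (Fin 44 → ZMod 2) := Matrix.toBilin' 1
  have hBv : ∀ u v, B u v = ∑ i, u i * v i := fun u v => by
    simp [B, Matrix.toBilin'_apply', dotProduct]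
  have hB : B.Nondegenerate :=
    (Matrix.nondegenerate_of_det_ne_zero (by rw [Matrix.det_one]; exact one_ne_zero)).toBilin'
  have hle : S ≤ B.orthogonal S := by
    refine Submodule.span_le.2 ?_
    rintro _ ⟨i, rfl⟩
    refine LinearMap.BilinForm.mem_orthogonal_iff.2 fun v hv => ?_
    rw [hBv]
    induction hv using Submodule.span_induction with
    | mem x hx => obtain ⟨j, rfl⟩ := hx; exact hg j i
    | zero => simp
    | add x y _ _ hx hy => simp [add_mul, sum_add_distrib, hx, hy]
    | smul a x _ hx => simp [mul_assoc, ← mul_sum, hx]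
  have heq : S = B.orthogonal S := Submodule.eq_of_le_of_finrank_eq hle (by
    rw [LinearMap.BilinForm.finrank_orthogonal hB, hrank]
    simp)
  refine ⟨fun u => ?_, hrank⟩
  conv_lhs => rw [heq]
  rw [LinearMap.BilinForm.mem_orthogonal_iff]
  simp only [hBv, mul_comm]

/-- Binary words of the sixteen standard hexads. -/
def hexads : List ℕ :=
  [63, 963, 7237, 57417, 458833, 3670113, 598086, 1180746, 2115666, 299106, 2359500, 1081684,
    148068, 528984, 67944, 9456]

lemma supp_bits_hexads : ∀ m ∈ hexads, supp (bits 22 m) = baseHexad ∨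
    ∃ a b, a ≠ b ∧ supp (bits 22 m) = pairHexad a b := by
  decide +kernel

lemma exists_hexads_pair : ∀ a b, a ≠ b → ∃ m ∈ hexads, supp (bits 22 m) = pairHexad a b := by
  decide +kernel

lemma supp_bits_base : supp (bits 22 63) = baseHexad := by decide +kernel

lemma popcount_hexads : ∀ m ∈ hexads, popcount 22 m = 6 := by decide +kernel

lemma exists_hexads_testBit : ∀ i : Fin 22, ∃ m ∈ hexads, m.testBit i := by decide +kernel

/-- Sums of the base hexad and ten other standard hexads. -/
def hexSums : List ℕ :=
  [963, 7237, 57417, 458833, 3670113, 598086, 1180746, 2115666, 2359500, 1081684].map (63 ^^^ ·)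

lemma exists_hexads_of_mem_hexSums : ∀ d ∈ hexSums, ∃ m ∈ hexads, d = 63 ^^^ m := by
  decide +kernel

/-- Generators common to the two standard codes. -/
def commonGens : List (ℕ × ℕ) := hexSums.map (·, 0) ++ hexSums.map (0, ·) ++ [(63, 63)]

/-- Generators of the standard code with glue vector `c`. -/
def gens (c : ℕ × ℕ) : List (ℕ × ℕ) := commonGens ++ [c]

/-- The code generated by sums of standard hexads on both sides and a glue vector. -/
def stdCode (c : ℕ × ℕ) : Submodule (ZMod 2) (Fin 44 → ZMod 2) :=
  Submodule.span (ZMod 2) (vec '' {p | p ∈ gens c})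

/-- The two possible glue vectors. -/
def glues : List (ℕ × ℕ) := [(1327175, 1327175), (63 ^^^ 1327175, 1327175)]

/-- A family of words dual to the generators. -/
def dualWords : List (ℕ × ℕ) :=
  [(508, 0), (3194, 0), (17477, 0), (18909, 0), (19819, 0), (16522, 0), (2170, 0), (1146, 0),
    (380, 0), (252, 0), (63, 451), (63, 3141), (0, 17477), (0, 18909), (63, 19796), (0, 16522),
    (63, 2117), (63, 1093), (63, 323), (63, 195), (63, 19723), (63, 0)]

end StandardCode

section StandardCodeProperties

lemma length_gens (c : ℕ × ℕ) : (gens c).length = 22 := rfl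

lemma range_gens (c : ℕ × ℕ) :
    Set.range (fun i : Fin 22 => vec ((gens c).getD i 0)) = vec '' {p | p ∈ gens c} := by
  ext v
  simp only [Set.mem_range, Set.mem_image, Set.mem_ofPred_eq]
  constructor
  · rintro ⟨i, rfl⟩
    refine ⟨_, ?_, rfl⟩
    rw [List.getD_eq_getElem _ _ (by rw [length_gens]; exact i.2)]
    exact List.getElem_mem _
  · rintro ⟨p, hp, rfl⟩
    obtain ⟨i, hi, rfl⟩ := List.mem_iff_getElem.1 hp
    exact ⟨⟨i, by rwa [length_gens] at hi⟩, by rw [List.getD_eq_getElem _ _ hi]⟩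

lemma gens_dot : ∀ c ∈ glues, ∀ i j : Fin 22,
    (popcount 22 (((gens c).getD i 0).1 &&& ((gens c).getD j 0).1) +
      popcount 22 (((gens c).getD i 0).2 &&& ((gens c).getD j 0).2)) % 2 = 0 := by
  decide +kernel

lemma gens_dot_dualWords : ∀ c ∈ glues, ∀ i j : Fin 22,
    (popcount 22 (((gens c).getD i 0).1 &&& (dualWords.getD j 0).1) +
      popcount 22 (((gens c).getD i 0).2 &&& (dualWords.getD j 0).2)) % 2 =
      if i = j then 1 else 0 := by
  decide +kernel

lemma stdCode_isSelfDual_and_finrank {c : ℕ × ℕ} (hc : c ∈ glues) :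
    isSelfDual (stdCode c) ∧ Module.finrank (ZMod 2) (stdCode c) = 22 := by
  rw [stdCode, ← range_gens]
  refine isSelfDual_span_of_dual (w := fun j => vec (dualWords.getD j 0)) (fun i j => ?_)
    fun i j => ?_
  · rw [dot_vec, ← ZMod.natCast_mod, gens_dot c hc]
    rfl
  · rw [dot_vec, ← ZMod.natCast_mod, gens_dot_dualWords c hc]
    split_ifs <;> rfl

lemma stdCode_isSelfDual {c : ℕ × ℕ} (hc : c ∈ glues) : isSelfDual (stdCode c) :=
  (stdCode_isSelfDual_and_finrank hc).1

lemma vec_mem_stdCode {c p : ℕ × ℕ} (hp : p ∈ gens c) : vec p ∈ stdCode c :=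
  Submodule.subset_span ⟨p, hp, rfl⟩

lemma dot_span_eq_zero {S : Set (ι → ZMod 2)} [Fintype ι] {u : ι → ZMod 2}
    (h : ∀ v ∈ S, ∑ i, u i * v i = 0) {v : ι → ZMod 2} (hv : v ∈ Submodule.span (ZMod 2) S) :
    ∑ i, u i * v i = 0 := by
  induction hv using Submodule.span_induction with
  | mem x hx => exact h x hx
  | zero => simp
  | add x y _ _ hx hy => simp [mul_add, sum_add_distrib, hx, hy]
  | smul a x _ hx => simp [mul_left_comm, ← mul_sum, hx]

lemma mem_stdCode_iff {c : ℕ × ℕ} (hc : c ∈ glues) {z : Fin 44 → ZMod 2} :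
    z ∈ stdCode c ↔ ∀ p ∈ gens c, ∑ i, z i * vec p i = 0 := by
  rw [stdCode_isSelfDual hc]
  refine ⟨fun h p hp => h _ (vec_mem_stdCode hp), fun h v hv => dot_span_eq_zero ?_ hv⟩
  rintro _ ⟨p, hp, rfl⟩
  exact h p hp

lemma mem_shadow_of_span {S : Set (Fin 44 → ZMod 2)}
    (hS : isSelfDual (Submodule.span (ZMod 2) S)) {u : Fin 44 → ZMod 2}
    (h : ∀ v ∈ S, ∑ i, u i * v i = ((wt v / 2 : ℕ) : ZMod 2)) :
    u ∈ shadow (Submodule.span (ZMod 2) S) := by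
  intro v hv
  induction hv using Submodule.span_induction with
  | mem x hx => exact h x hx
  | zero => simp [wt_zero]
  | add x y hx hy ihx ihy =>
    rw [hS.half_wt_add hx hy, ← ihx, ← ihy, ← sum_add_distrib]
    simp [mul_add]
  | smul a x _ hx =>
    rcases zmod_two_cases a with rfl | rfl
    · simp [wt_zero]
    · simpa using hx

/-- The two words of a standard hexad, one for each half. -/
def hexadWords (m : ℕ) : List (ℕ × ℕ) := [(m, 0), (0, m)]

lemma hexadWords_dot : ∀ c ∈ glues, ∀ m ∈ hexads, ∀ q ∈ hexadWords m, ∀ p ∈ gens c,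
    (popcount 22 (q.1 &&& p.1) + popcount 22 (q.2 &&& p.2)) % 2 =
      (popcount 22 p.1 + popcount 22 p.2) / 2 % 2 := by
  decide +kernel

lemma hexad_mem_shadow {c : ℕ × ℕ} (hc : c ∈ glues) {m : ℕ} (hm : m ∈ hexads) {q : ℕ × ℕ}
    (hq : q ∈ hexadWords m) : vec q ∈ shadow (stdCode c) := by
  refine mem_shadow_of_span (stdCode_isSelfDual hc) ?_
  rintro _ ⟨p, hp, rfl⟩
  rw [dot_vec, wt_vec, ← ZMod.natCast_mod, hexadWords_dot c hc m hm q hq p hp, ZMod.natCast_mod]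

lemma popcount_sums : ∀ m ∈ sums hexSums,
    (popcount 22 m = 0 ∨ popcount 22 m = 8 ∨ 12 ≤ popcount 22 m) ∧
    6 ≤ popcount 22 (m ^^^ 63) ∧ 7 ≤ popcount 22 (m ^^^ 1327175) ∧
    7 ≤ popcount 22 (m ^^^ (63 ^^^ 1327175)) := by
  decide +kernel

lemma exists_of_mem_stdCode {c : ℕ × ℕ} {v : Fin 44 → ZMod 2} (hv : v ∈ stdCode c) :
    ∃ a ∈ sums hexSums, ∃ b ∈ sums hexSums,
      v = vec (a, b) ∨ v = vec (a ^^^ 63, b ^^^ 63) ∨ v = vec (a ^^^ c.1, b ^^^ c.2) ∨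
        v = vec (a ^^^ (63 ^^^ c.1), b ^^^ (63 ^^^ c.2)) := by
  have hset : vec '' {p | p ∈ gens c} ⊆ ((fun m => vec (m, 0)) '' {m | m ∈ hexSums} ∪
      (fun m => vec (0, m)) '' {m | m ∈ hexSums}) ∪ {vec (63, 63), vec c} := by
    rintro _ ⟨p, hp, rfl⟩
    simp only [gens, commonGens, Set.mem_ofPred_eq, List.mem_append, List.mem_map,
      List.mem_singleton] at hp
    rcases hp with ((⟨m, hm, rfl⟩ | ⟨m, hm, rfl⟩) | rfl) | rfl
    · exact Or.inl (Or.inl ⟨m, hm, rfl⟩)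
    · exact Or.inl (Or.inr ⟨m, hm, rfl⟩)
    · exact Or.inr (Or.inl rfl)
    · exact Or.inr (Or.inr rfl)
  have h := Submodule.span_mono hset hv
  rw [Submodule.span_union, Submodule.span_union, Submodule.mem_sup] at h
  obtain ⟨x, hx, y, hy, rfl⟩ := h
  obtain ⟨x₁, hx₁, x₂, hx₂, rfl⟩ := Submodule.mem_sup.1 hx
  obtain ⟨a, ha, rfl⟩ := exists_sums vec_zero
    (fun a b => by simpa using vec_xor a b 0 0) hexSums hx₁
  obtain ⟨b, hb, rfl⟩ := exists_sums vec_zero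
    (fun a b => by simpa using vec_xor 0 0 a b) hexSums hx₂
  obtain ⟨s, t, rfl⟩ := Submodule.mem_span_pair.1 hy
  refine ⟨a, ha, b, hb, ?_⟩
  have hab : vec (a, 0) + vec (0, b) = vec (a, b) := by
    rw [← vec_xor]
    simp
  obtain ⟨c₁, c₂⟩ := c
  simp only [hab, vec_xor]
  rcases zmod_two_cases s with rfl | rfl <;> rcases zmod_two_cases t with rfl | rfl <;> simp

/-- The standard code. -/
def std : Submodule (ZMod 2) (Fin 44 → ZMod 2) := stdCode (1327175, 1327175)

lemma std_isSelfDual : isSelfDual std := stdCode_isSelfDual (by decide)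

lemma wt_of_mem_std {v : Fin 44 → ZMod 2} (hv : v ∈ std) : wt v = 0 ∨ wt v = 8 ∨ 12 ≤ wt v := by
  obtain ⟨a, ha, b, hb, h⟩ := exists_of_mem_stdCode hv
  have h1 := popcount_sums a ha
  have h2 := popcount_sums b hb
  rcases h with rfl | rfl | rfl | rfl <;> rw [wt_vec] <;> dsimp only <;> omega

lemma weightCount_eq_zero [Fintype ι] [DecidableEq ι] {S : Set (ι → ZMod 2)} {w : ℕ} :
    weightCount S w = 0 ↔ ∀ v ∈ S, wt v ≠ w := by
  simp [weightCount, filter_eq_empty_iff]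

lemma weightCount_shadow_std : weightCount (shadow std) 2 = 0 := by
  refine weightCount_eq_zero.2 fun v hv hw => ?_
  have hpos : 0 < #(supp v) := by rw [card_supp, hw]; norm_num
  obtain ⟨i, hi⟩ := card_pos.1 hpos
  have hq : ∃ m ∈ hexads, ∃ q ∈ hexadWords m, i ∈ supp (vec q) := by
    rcases half_cases i with ⟨j, rfl⟩ | ⟨j, rfl⟩ <;>
    obtain ⟨m, hm, hj⟩ := exists_hexads_testBit j
    · exact ⟨m, hm, (m, 0), by simp [hexadWords], by simp [mem_supp, vec_left, bits, hj]⟩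
    · exact ⟨m, hm, (0, m), by simp [hexadWords], by simp [mem_supp, vec_right, bits, hj]⟩
  obtain ⟨m, hm, q, hq, hiq⟩ := hq
  have hwq : wt (vec q) = 6 := by
    have hz : popcount 22 0 = 0 := rfl
    have h6 := popcount_hexads m hm
    simp only [hexadWords, List.mem_cons, List.not_mem_nil, or_false] at hq
    rcases hq with rfl | rfl <;> simp [wt_vec, hz, h6]
  have hmem := std_isSelfDual.add_mem_of_mem_shadow hv (hexad_mem_shadow (by decide) hm hq)
  have h1 := wt_add v (vec q)
  have h2 := wt_of_mem_std hmem
  have h3 : 0 < #(supp v ∩ supp (vec q)) := card_pos.2 ⟨i, mem_inter.2 ⟨hi, hiq⟩⟩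
  have h4 : #(supp v ∩ supp (vec q)) ≤ #(supp v) := card_le_card inter_subset_left
  rw [card_supp] at h4
  omega

end StandardCodeProperties

section Permutations

variable {C D : Submodule (ZMod 2) (ι → ZMod 2)} {σ τ : Equiv.Perm ι} {v : ι → ZMod 2}

lemma mem_permCode : v ∈ permCode σ C ↔ v ∘ σ.symm ∈ C := by
  constructor
  · rintro ⟨w, hw, rfl⟩
    have : permLM σ w ∘ σ.symm = w := by
      funext i
      simp [permLM]
    rwa [this]
  · intro h
    refine ⟨_, h, ?_⟩
    funext i
    simp [permLM]

lemma permCode_permCode : permCode τ (permCode σ C) = permCode (σ * τ) C := by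
  ext v
  simp only [mem_permCode]
  rfl

lemma permCode_one : permCode 1 C = C := by
  ext v
  rw [mem_permCode]
  rfl

lemma permCode_eq_iff : permCode σ C = D ↔ C = permCode σ⁻¹ D := by
  constructor <;> rintro rfl <;> simp [permCode_permCode, permCode_one]

variable [Fintype ι]

lemma wt_comp : wt (v ∘ σ) = wt v := by
  simp only [wt, card_filter]
  exact Equiv.sum_comp σ fun i => if v i ≠ 0 then 1 else 0

lemma dot_comp_symm (u v : ι → ZMod 2) :
    ∑ i, u i * (v ∘ σ) i = ∑ i, (u ∘ σ.symm) i * v i := by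
  rw [← Equiv.sum_comp σ fun i => (u ∘ σ.symm) i * v i]
  simp

lemma isSelfDual.permCode (hC : isSelfDual C) : isSelfDual (permCode σ C) := by
  intro u
  rw [mem_permCode, hC]
  constructor
  · rintro h _ ⟨w, hw, rfl⟩
    exact (dot_comp_symm u w).trans (h w hw)
  · intro h w hw
    rw [← dot_comp_symm]
    exact h _ ⟨w, hw, rfl⟩

lemma mem_shadow_permCode : v ∈ shadow (permCode σ C) ↔ v ∘ σ.symm ∈ shadow C := by
  constructor
  · intro h w hw
    rw [← dot_comp_symm, ← wt_comp (σ := σ)]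
    exact h _ ⟨w, hw, rfl⟩
  · rintro h _ ⟨w, hw, rfl⟩
    exact (dot_comp_symm v w).trans ((h w hw).trans (by rw [← wt_comp (σ := σ)]; rfl))

lemma supp_comp_symm [DecidableEq ι] : supp (v ∘ σ.symm) = (supp v).image σ := by
  ext i
  simp only [mem_supp, mem_image, Function.comp]
  exact ⟨fun h => ⟨_, h, σ.apply_symm_apply i⟩, by rintro ⟨j, hj, rfl⟩; simpa using hj⟩

lemma isSelfDual.eq_of_le (hC : isSelfDual C) (hD : isSelfDual D) (h : C ≤ D) : C = D :=
  le_antisymm h fun u hu => (hC u).2 fun v hv => (hD u).1 hu v (h hv)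

end Permutations

section Recognition

variable {C : Submodule (ZMod 2) (Fin 44 → ZMod 2)}

/-- All standard hexads of both halves lie in the shadow of `C`. -/
def ContainsHexads (C : Submodule (ZMod 2) (Fin 44 → ZMod 2)) : Prop :=
  ∀ m ∈ hexads, ∀ q ∈ hexadWords m, vec q ∈ shadow C

lemma ContainsHexads.commonGens_mem (h : ContainsHexads C) (hC : isSelfDual C) :
    ∀ p ∈ commonGens, vec p ∈ C := by
  have hb : 63 ∈ hexads := by decide
  intro p hp
  simp only [commonGens, List.mem_append, List.mem_map, List.mem_singleton] at hp
  rcases hp with (⟨d, hd, rfl⟩ | ⟨d, hd, rfl⟩) | rfl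
  · obtain ⟨m, hm, rfl⟩ := exists_hexads_of_mem_hexSums d hd
    have := vec_xor 63 m 0 0
    rw [Nat.xor_self] at this
    rw [this]
    exact hC.add_mem_of_mem_shadow (h 63 hb _ (by simp [hexadWords]))
      (h m hm _ (by simp [hexadWords]))
  · obtain ⟨m, hm, rfl⟩ := exists_hexads_of_mem_hexSums d hd
    have := vec_xor 0 0 63 m
    rw [Nat.xor_self] at this
    rw [this]
    exact hC.add_mem_of_mem_shadow (h 63 hb _ (by simp [hexadWords]))
      (h m hm _ (by simp [hexadWords]))
  · have := vec_xor 63 0 0 63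
    simp only [Nat.xor_zero, Nat.zero_xor] at this
    rw [this]
    exact hC.add_mem_of_mem_shadow (h 63 hb _ (by simp [hexadWords]))
      (h 63 hb _ (by simp [hexadWords]))

lemma base_dot_commonGens : ∀ p ∈ commonGens,
    (popcount 22 (63 &&& p.1) + popcount 22 (0 &&& p.2)) % 2 = 0 := by
  decide +kernel

lemma base_dot_glues : ∀ p ∈ glues,
    (popcount 22 (63 &&& p.1) + popcount 22 (0 &&& p.2)) % 2 = 1 := by
  decide +kernel

lemma ContainsHexads.eq_stdCode (h : ContainsHexads C) (hC : isSelfDual C)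
    (h6 : ∀ v ∈ C, wt v ≠ 6) : ∃ c ∈ glues, C = stdCode c := by
  have hwt : wt (vec (63, 0)) = 6 := by
    rw [wt_vec]
    decide +kernel
  have hcommon := h.commonGens_mem hC
  have horth : ∀ z ∈ C, ∀ p ∈ commonGens, ∑ i, z i * vec p i = 0 := fun z hz p hp =>
    (hC z).1 hz _ (hcommon p hp)
  have hstd : ∀ c ∈ glues, ∀ z, (∀ p ∈ commonGens, ∑ i, z i * vec p i = 0) →
      ∑ i, z i * vec c i = 0 → z ∈ stdCode c := fun c hc z hz hzc => by
    refine (mem_stdCode_iff hc).2 fun p hp => ?_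
    rcases List.mem_append.1 hp with hp | hp
    · exact hz p hp
    · rw [List.mem_singleton.1 hp]
      exact hzc
  by_contra hne
  push Not at hne
  have hex : ∀ c ∈ glues, ∃ z ∈ C, ∑ i, z i * vec c i = 1 := fun c hc => by
    by_contra hno
    push Not at hno
    exact hne c hc (hC.eq_of_le (stdCode_isSelfDual hc) fun z hz =>
      hstd c hc z (horth z hz) ((zmod_two_cases _).resolve_right (hno z hz)))
  set c₁ : ℕ × ℕ := (1327175, 1327175) with hc₁
  set c₂ : ℕ × ℕ := (63 ^^^ 1327175, 1327175) with hc₂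
  have hm₁ : c₁ ∈ glues := by decide
  have hm₂ : c₂ ∈ glues := by decide
  have hglue : ∀ c ∈ glues, c = c₁ ∨ c = c₂ := by decide
  set b : Fin 44 → ZMod 2 := vec (63, 0) with hb
  have hsum : ∀ z : Fin 44 → ZMod 2,
      ∑ i, z i * vec c₂ i = ∑ i, z i * b i + ∑ i, z i * vec c₁ i := fun z => by
    have : vec c₂ = b + vec c₁ := by
      have := vec_xor 63 1327175 0 1327175
      rwa [Nat.zero_xor] at this
    rw [this, ← sum_add_distrib]
    simp only [Pi.add_apply, mul_add]
  obtain ⟨y, hy, hy₁, hy₂⟩ : ∃ y ∈ C, ∑ i, y i * vec c₁ i = 1 ∧ ∑ i, y i * vec c₂ i = 1 := by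
    obtain ⟨z, hz, hz₁⟩ := hex c₁ hm₁
    obtain ⟨w, hw, hw₂⟩ := hex c₂ hm₂
    rcases zmod_two_cases (∑ i, z i * vec c₂ i) with hz₂ | hz₂
    · rcases zmod_two_cases (∑ i, w i * vec c₁ i) with hw₁ | hw₁
      · refine ⟨z + w, C.add_mem hz hw, ?_, ?_⟩ <;>
          simp [add_mul, sum_add_distrib, hz₁, hz₂, hw₁, hw₂]
      · exact ⟨w, hw, hw₁, hw₂⟩
    · exact ⟨z, hz, hz₁, hz₂⟩
  have hbc : ∀ p ∈ commonGens, ∑ i, b i * vec p i = 0 := fun p hp => by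
    rw [hb, dot_vec, ← ZMod.natCast_mod, base_dot_commonGens p hp]
    rfl
  have hbg : ∀ p ∈ glues, ∑ i, b i * vec p i = 1 := fun p hp => by
    rw [hb, dot_vec, ← ZMod.natCast_mod, base_dot_glues p hp]
    rfl
  have hyb : ∀ c ∈ glues, y + b ∈ stdCode c := fun c hc => by
    refine hstd c hc _ (fun p hp => ?_) ?_
    · simp [add_mul, sum_add_distrib, horth y hy p hp, hbc p hp]
    · rcases hglue c hc with rfl | rfl
      · simp only [Pi.add_apply, add_mul, sum_add_distrib, hy₁, hbg _ hc]
        rfl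
      · simp only [Pi.add_apply, add_mul, sum_add_distrib, hy₂, hbg _ hc]
        rfl
  have hzero : ∀ c ∈ glues, ∀ z ∈ C, ∑ i, z i * vec c i = 0 → ∑ i, b i * z i = 0 :=
    fun c hc z hz h0 => by
      have h1 := (stdCode_isSelfDual hc _).1 (hyb c hc) z (hstd c hc z (horth z hz) h0)
      have h2 := (hC y).1 hy z hz
      simpa [add_mul, sum_add_distrib, h2] using h1
  have hbC : b ∈ C := (hC b).2 fun z hz => by
    rcases zmod_two_cases (∑ i, z i * vec c₁ i) with h₁ | h₁
    · exact hzero c₁ hm₁ z hz h₁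
    rcases zmod_two_cases (∑ i, z i * vec c₂ i) with h₂ | h₂
    · exact hzero c₂ hm₂ z hz h₂
    have h₀ := hsum z
    rw [h₁, h₂] at h₀
    refine (sum_congr rfl fun i _ => mul_comm (b i) (z i)).trans ?_
    exact left_eq_add.1 (h₀.trans (add_comm _ _))
  exact h6 b hbC hwt

end Recognition

section StandardAutomorphisms

/-- The permutation of the first half induced by a permutation of 22 points. -/
def leftPerm (s : Equiv.Perm (Fin 22)) : Equiv.Perm (Fin 44) :=
  (finSumFinEquiv (m := 22) (n := 22)).permCongr (Equiv.sumCongr s (Equiv.refl _))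

lemma leftPerm_left (s : Equiv.Perm (Fin 22)) (i : Fin 22) : leftPerm s (left i) = left (s i) :=
  congrArg (fun x => finSumFinEquiv (m := 22) (n := 22) (Sum.map s id x))
    (finSumFinEquiv_symm_apply_castAdd i)

lemma leftPerm_right (s : Equiv.Perm (Fin 22)) (i : Fin 22) : leftPerm s (right i) = right i :=
  congrArg (fun x => finSumFinEquiv (m := 22) (n := 22) (Sum.map s id x))
    (finSumFinEquiv_symm_apply_natAdd i)

/-- The permutation of standard points induced by a transposition of the base hexad. -/
def swapTable : Fin 22 → Fin 22 :=
  ![1, 0, 2, 3, 4, 5, 6, 7, 8, 9, 13, 16, 19, 10, 17, 20, 11, 14, 21, 12, 15, 18]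

/-- The involution of standard points induced by a transposition of the base hexad. -/
def swapPerm : Equiv.Perm (Fin 22) where
  toFun := swapTable
  invFun := swapTable
  left_inv := by decide
  right_inv := by decide

/-- The permutation of standard points induced by a 3-cycle on the base hexad. -/
def rotTable : Fin 22 → Fin 22 :=
  ![1, 2, 0, 3, 4, 5, 6, 13, 16, 19, 7, 8, 9, 10, 20, 17, 11, 21, 14, 12, 18, 15]

lemma rotTable_cube : ∀ i, rotTable (rotTable (rotTable i)) = i := by decide

/-- The element of order 3 on standard points induced by a 3-cycle on the base hexad. -/
def rotPerm : Equiv.Perm (Fin 22) where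
  toFun := rotTable
  invFun i := rotTable (rotTable i)
  left_inv := rotTable_cube
  right_inv := rotTable_cube

lemma permCode_stdCode {s : Equiv.Perm (Fin 22)} {c d : ℕ × ℕ} (hc : c ∈ glues) (hd : d ∈ glues)
    (h : ∀ p ∈ gens c, ∀ q ∈ gens d,
      ∑ i, bits 22 p.1 (s i) * bits 22 q.1 i + (popcount 22 (p.2 &&& q.2) : ZMod 2) = 0) :
    permCode (leftPerm s) (stdCode c) = stdCode d := by
  refine (stdCode_isSelfDual hc).permCode.eq_of_le (stdCode_isSelfDual hd) ?_
  refine Submodule.map_le_iff_le_comap.2 (Submodule.span_le.2 ?_)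
  rintro _ ⟨p, hp, rfl⟩
  refine (mem_stdCode_iff hd).2 fun q hq => ?_
  rw [← h p hp q hq, sum_halves, ← dot_bits]
  simp [permLM, leftPerm_left, leftPerm_right, vec_left, vec_right]

lemma swap_stdCode : permCode (leftPerm swapPerm) std = stdCode (63 ^^^ 1327175, 1327175) :=
  permCode_stdCode (by decide) (by decide) (by decide +kernel)

lemma rot_stdCode : permCode (leftPerm rotPerm) std = std :=
  permCode_stdCode (by decide) (by decide) (by decide +kernel)

lemma leftPerm_swapPerm_mul_self : leftPerm swapPerm * leftPerm swapPerm = 1 := by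
  ext i
  rcases half_cases i with ⟨j, rfl⟩ | ⟨j, rfl⟩
  · simp only [Equiv.Perm.mul_apply, leftPerm_left]
    rw [show swapPerm (swapPerm j) = j from swapPerm.left_inv j]
    rfl
  · simp [leftPerm_right]

lemma orderOf_leftPerm_rotPerm : orderOf (leftPerm rotPerm) = 3 := by
  have : Fact (Nat.Prime 3) := ⟨Nat.prime_three⟩
  refine orderOf_eq_prime ?_ fun h => ?_
  · ext i
    rcases half_cases i with ⟨j, rfl⟩ | ⟨j, rfl⟩
    · simp only [pow_succ, pow_zero, one_mul, Equiv.Perm.mul_apply, leftPerm_left]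
      rw [show rotPerm (rotPerm (rotPerm j)) = j from rotTable_cube j]
      rfl
    · simp [pow_succ, leftPerm_right]
  · have h0 := DFunLike.congr_fun h (left 0)
    rw [leftPerm_left] at h0
    exact absurd (left_injective h0) (by decide)

end StandardAutomorphisms

section ShadowHexads

/-- The supports of the vectors of weight 6 in the shadow of a code. -/
noncomputable def hexadSystem (C : Submodule (ZMod 2) (Fin 44 → ZMod 2)) : Finset (Finset (Fin 44)) :=
  (Set.toFinite (supp '' {v | v ∈ shadow C ∧ wt v = 6})).toFinset

/-- Self-dual codes of length 44 with minimum weight at least 8, no words of weight 10, and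
154 words of weight 6 in the shadow. -/
structure HexadCode (C : Submodule (ZMod 2) (Fin 44 → ZMod 2)) : Prop where
  selfDual : isSelfDual C
  wt_cases : ∀ v ∈ C, wt v = 0 ∨ wt v = 8 ∨ 12 ≤ wt v
  card_shadow : weightCount (shadow C) 6 = 154

variable {C : Submodule (ZMod 2) (Fin 44 → ZMod 2)}

lemma mem_hexadSystem {B : Finset (Fin 44)} :
    B ∈ hexadSystem C ↔ ∃ v, (v ∈ shadow C ∧ wt v = 6) ∧ supp v = B := by
  rw [hexadSystem, Set.Finite.mem_toFinset]
  rfl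

lemma supp_mem_hexadSystem {v : Fin 44 → ZMod 2} (hv : wt v = 6) :
    supp v ∈ hexadSystem C ↔ v ∈ shadow C := by
  rw [mem_hexadSystem]
  constructor
  · rintro ⟨w, ⟨hw, -⟩, h⟩
    rwa [← supp_injective h]
  · exact fun h => ⟨v, ⟨h, hv⟩, rfl⟩

lemma weightCount_eq_ncard {S : Set (Fin 44 → ZMod 2)} {w : ℕ} :
    weightCount S w = {v | v ∈ S ∧ wt v = w}.ncard := by
  classical
  rw [weightCount, ← Set.ncard_coe_finset, coe_filter_univ]

lemma HexadCode.card_hexadSystem (hC : HexadCode C) : #(hexadSystem C) = 154 := by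
  rw [hexadSystem, ← Set.ncard_eq_toFinset_card, Set.ncard_image_of_injective _ supp_injective,
    ← hC.card_shadow, weightCount_eq_ncard]

lemma HexadCode.sextetSystem (hC : HexadCode C) : SextetSystem (hexadSystem C) := by
  constructor
  · intro B hB
    obtain ⟨v, ⟨-, hv⟩, rfl⟩ := mem_hexadSystem.1 hB
    rw [card_supp, hv]
  · intro B hB B' hB' hne
    obtain ⟨u, ⟨hu, hu6⟩, rfl⟩ := mem_hexadSystem.1 hB
    obtain ⟨v, ⟨hv, hv6⟩, rfl⟩ := mem_hexadSystem.1 hB'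
    have hadd := wt_add u v
    have hpos : 0 < wt (u + v) := wt_pos fun h => hne <| congrArg supp <| by
      rw [← CharTwo.neg_eq v]
      exact eq_neg_of_add_eq_zero_left h
    rcases hC.wt_cases _ (hC.selfDual.add_mem_of_mem_shadow hu hv) with h | h | h <;> omega

lemma supp_vec_left (m : ℕ) : supp (vec (m, 0)) = (supp (bits 22 m)).image left := by
  ext i
  rcases half_cases i with ⟨j, rfl⟩ | ⟨j, rfl⟩
  · simp [mem_supp, vec_left, left_injective.eq_iff]
  · simp [mem_supp, vec_right, left_ne_right, bits]

lemma supp_vec_right (m : ℕ) : supp (vec (0, m)) = (supp (bits 22 m)).image right := by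
  ext i
  rcases half_cases i with ⟨j, rfl⟩ | ⟨j, rfl⟩
  · simp [mem_supp, vec_left, fun i j => (left_ne_right i j).symm, bits]
  · simp [mem_supp, vec_right, right_injective.eq_iff]

lemma labelling_iff {α : Type*} [DecidableEq α] {H : Finset (Finset α)} {f : Fin 22 → α}
    (hf : Function.Injective f) :
    Labelling H f ↔ ∀ m ∈ hexads, (supp (bits 22 m)).image f ∈ H := by
  constructor
  · intro h m hm
    rcases supp_bits_hexads m hm with h' | ⟨a, b, hab, h'⟩ <;> rw [h']
    exacts [h.base_mem, h.pair_mem a b hab]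
  · refine fun h => ⟨hf, ?_, fun a b hab => ?_⟩
    · rw [← supp_bits_base]
      exact h 63 (by decide)
    · obtain ⟨m, hm, h'⟩ := exists_hexads_pair a b hab
      rw [← h']
      exact h m hm

lemma containsHexads_permCode {σ : Equiv.Perm (Fin 44)} : ContainsHexads (permCode σ C) ↔
    Labelling (hexadSystem C) (σ ∘ left) ∧ Labelling (hexadSystem C) (σ ∘ right) := by
  have hwt : ∀ m ∈ hexads, ∀ q ∈ hexadWords m, wt (vec q ∘ σ.symm) = 6 := fun m hm q hq => by
    rw [wt_comp, wt_vec]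
    have h6 := popcount_hexads m hm
    have h0 : popcount 22 0 = 0 := by decide
    simp only [hexadWords, List.mem_cons, List.not_mem_nil, or_false] at hq
    rcases hq with rfl | rfl <;> simp only [h6, h0]
  have key : ∀ m ∈ hexads, (∀ q ∈ hexadWords m, vec q ∈ shadow (permCode σ C)) ↔
      (supp (bits 22 m)).image (σ ∘ left) ∈ hexadSystem C ∧
      (supp (bits 22 m)).image (σ ∘ right) ∈ hexadSystem C := fun m hm => by
    rw [← image_image, ← image_image, ← supp_vec_left, ← supp_vec_right, ← supp_comp_symm,
      ← supp_comp_symm, supp_mem_hexadSystem (hwt m hm _ (by simp [hexadWords])),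
      supp_mem_hexadSystem (hwt m hm _ (by simp [hexadWords])), ← mem_shadow_permCode,
      ← mem_shadow_permCode]
    simp [hexadWords]
  rw [labelling_iff (σ.injective.comp left_injective),
    labelling_iff (σ.injective.comp right_injective), ← forall₂_and]
  exact forall₂_congr key

end ShadowHexads

section Counting

variable {α : Type*} [DecidableEq α]

lemma Labelling.image_subset {H : Finset (Finset α)} {f : Fin 22 → α} (hf : Labelling H f)
    {K : Finset α} (hK : ∀ B ∈ H, B ⊆ K) (i : Fin 22) : f i ∈ K := by
  obtain ⟨m, hm, hi⟩ := exists_hexads_testBit i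
  have hi' : i ∈ supp (bits 22 m) := mem_supp.2 (by simp [bits, hi])
  exact hK _ ((labelling_iff hf.injective).1 hf m hm) (mem_image_of_mem f hi')

lemma Labelling.cases [Fintype α] {H : Finset (Finset α)} {f : Fin 22 → α} (hf : Labelling H f)
    {K : Finset α} (hK : ∀ B ∈ H, B ⊆ K ∨ B ⊆ Kᶜ) :
    Labelling {B ∈ H | B ⊆ K} f ∨ Labelling {B ∈ H | B ⊆ Kᶜ} f := by
  have hbase : ∀ a, hexPt a ∈ baseHexad := by decide
  have meet : ∀ L M : Finset α, Disjoint L M → (∀ B ∈ H, B ⊆ L ∨ B ⊆ M) →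
      baseHexad.image f ⊆ L → Labelling {B ∈ H | B ⊆ L} f := fun L M hLM hH hb => by
    refine ⟨hf.injective, mem_filter.2 ⟨hf.base_mem, hb⟩, fun a b hab =>
      mem_filter.2 ⟨hf.pair_mem a b hab, ?_⟩⟩
    refine (hH _ (hf.pair_mem a b hab)).resolve_right fun h => ?_
    have h₁ : f (hexPt a) ∈ baseHexad.image f := mem_image_of_mem f (hbase a)
    have h₂ : f (hexPt a) ∈ (pairHexad a b).image f := mem_image_of_mem f (by simp [pairHexad])
    exact disjoint_left.1 hLM (hb h₁) (h h₂)
  rcases hK _ hf.base_mem with h | h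
  · exact Or.inl (meet K Kᶜ disjoint_compl_right hK h)
  · exact Or.inr (meet Kᶜ K disjoint_compl_left (fun B hB => (hK B hB).symm) h)

/-- Labellings of two complementary Steiner systems are the two halves of permutations. -/
lemma card_labelling_pair {K : Finset (Fin 44)} {H H' : Finset (Finset (Fin 44))}
    (hH : Steiner K H) (hH' : Steiner Kᶜ H') :
    Nat.card {σ : Equiv.Perm (Fin 44) // Labelling H (σ ∘ left) ∧ Labelling H' (σ ∘ right)} =
      887040 * 887040 := by
  rw [← hH.card_labelling]
  nth_rewrite 2 [hH.card_labelling]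
  rw [← hH'.card_labelling, ← Nat.card_prod]
  refine Nat.card_congr (Equiv.ofBijective (fun σ => (⟨σ.1 ∘ left, σ.2.1⟩, ⟨σ.1 ∘ right, σ.2.2⟩))
    ⟨fun σ τ h => ?_, fun p => ?_⟩)
  · simp only [Prod.mk.injEq, Subtype.mk.injEq] at h
    refine Subtype.ext (Equiv.ext fun i => ?_)
    rcases half_cases i with ⟨j, rfl⟩ | ⟨j, rfl⟩
    exacts [congrFun h.1 j, congrFun h.2 j]
  · obtain ⟨⟨f, hf⟩, ⟨g, hg⟩⟩ := p
    have hne : ∀ i j, f i ≠ g j := fun i j h =>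
      mem_compl.1 (hg.image_subset hH'.subset j) (h ▸ hf.image_subset hH.subset i)
    let e : Fin 44 → Fin 44 := Fin.append (m := 22) (n := 22) f g
    have hl : ∀ i, e (left i) = f i := Fin.append_left f g
    have hr : ∀ i, e (right i) = g i := Fin.append_right f g
    have he : Function.Injective e := fun i j h => by
      rcases half_cases i with ⟨i, rfl⟩ | ⟨i, rfl⟩ <;>
        rcases half_cases j with ⟨j, rfl⟩ | ⟨j, rfl⟩ <;> simp only [hl, hr] at h
      · rw [hf.injective h]
      · exact (hne _ _ h).elim
      · exact (hne _ _ h.symm).elim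
      · rw [hg.injective h]
    have hfe : e ∘ left = f := funext hl
    have hge : e ∘ right = g := funext hr
    refine ⟨⟨Equiv.ofBijective e he.bijective_of_finite, ?_, ?_⟩, ?_⟩
    · exact hfe.symm ▸ hf
    · exact hge.symm ▸ hg
    · exact Prod.ext (Subtype.ext hfe) (Subtype.ext hge)

end Counting

section Isomorphisms

variable {C : Submodule (ZMod 2) (Fin 44 → ZMod 2)}

lemma HexadCode.ncard_containsHexads (hC : HexadCode C) :
    {σ : Equiv.Perm (Fin 44) | ContainsHexads (permCode σ C)}.ncard =
      2 * (887040 * 887040) := by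
  obtain ⟨K, hS, hS', hK⟩ := hC.sextetSystem.exists_steiner (Fintype.card_fin 44)
    hC.card_hexadSystem
  have hS'' : Steiner Kᶜᶜ {B ∈ hexadSystem C | B ⊆ K} := by rwa [compl_compl]
  set H := hexadSystem C
  set H₁ := {B ∈ H | B ⊆ K}
  set H₂ := {B ∈ H | B ⊆ Kᶜ}
  have hH₁ : H₁ ⊆ H := filter_subset _ _
  have hH₂ : H₂ ⊆ H := filter_subset _ _
  have hunion : {σ : Equiv.Perm (Fin 44) | ContainsHexads (permCode σ C)} =
      {σ : Equiv.Perm (Fin 44) | Labelling H₁ (σ ∘ left) ∧ Labelling H₂ (σ ∘ right)} ∪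
      {σ : Equiv.Perm (Fin 44) | Labelling H₂ (σ ∘ left) ∧ Labelling H₁ (σ ∘ right)} := by
    ext σ
    simp only [Set.mem_ofPred_eq, Set.mem_union, containsHexads_permCode]
    have clash : ∀ L : Finset (Fin 44), #L = 22 → (∀ i, σ (left i) ∈ L) →
        ¬ ∀ i, σ (right i) ∈ L := fun L hL h₁ h₂ => by
      have : univ.image σ ⊆ L := fun x hx => by
        obtain ⟨i, -, rfl⟩ := mem_image.1 hx
        rcases half_cases i with ⟨j, rfl⟩ | ⟨j, rfl⟩
        exacts [h₁ j, h₂ j]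
      have h := card_le_card this
      rw [card_image_of_injective _ σ.injective, card_univ, Fintype.card_fin, hL] at h
      omega
    constructor
    · rintro ⟨hl, hr⟩
      rcases hl.cases hK with h₁ | h₁ <;> rcases hr.cases hK with h₂ | h₂
      · exact (clash K hS.card_points (h₁.image_subset hS.subset)
          (h₂.image_subset hS.subset)).elim
      · exact Or.inl ⟨h₁, h₂⟩
      · exact Or.inr ⟨h₁, h₂⟩
      · exact (clash Kᶜ hS'.card_points (h₁.image_subset hS'.subset)
          (h₂.image_subset hS'.subset)).elim
    · rintro (⟨h₁, h₂⟩ | ⟨h₁, h₂⟩)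
      · exact ⟨labelling_congr hH₁ h₁, labelling_congr hH₂ h₂⟩
      · exact ⟨labelling_congr hH₂ h₁, labelling_congr hH₁ h₂⟩
  rw [hunion, Set.ncard_union_eq, two_mul]
  · exact congrArg₂ (· + ·) (card_labelling_pair hS hS') (card_labelling_pair hS' hS'')
  · refine Set.disjoint_left.2 fun σ h h' => ?_
    exact mem_compl.1 (h'.1.image_subset hS'.subset 0) (h.1.image_subset hS.subset 0)

lemma containsHexads_stdCode {c : ℕ × ℕ} (hc : c ∈ glues) : ContainsHexads (stdCode c) :=
  fun _ hm _ hq => hexad_mem_shadow hc hm hq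

lemma stdCode_ne_std : stdCode (63 ^^^ 1327175, 1327175) ≠ std := fun h => by
  have h₁ : vec (63 ^^^ 1327175, 1327175) ∈ std := by
    rw [← h]
    exact vec_mem_stdCode (List.mem_append_right _ (List.mem_singleton.2 rfl))
  have h₂ : vec (1327175, 1327175) ∈ std :=
    vec_mem_stdCode (List.mem_append_right _ (List.mem_singleton.2 rfl))
  have h₃ := vec_xor 63 1327175 0 1327175
  rw [Nat.zero_xor] at h₃
  have h₄ : vec (63, 0) ∈ std := by
    refine (Submodule.add_mem_iff_left _ h₂).1 ?_
    rwa [← h₃]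
  have h₅ : wt (vec (63, 0)) = 6 := by
    rw [wt_vec]
    decide +kernel
  have h₆ := wt_of_mem_std h₄
  omega

lemma HexadCode.card_isomorphism (hC : HexadCode C) :
    Nat.card {σ : Equiv.Perm (Fin 44) // permCode σ C = std} = 786839961600 := by
  have h := hC.ncard_containsHexads
  have hunion : {σ : Equiv.Perm (Fin 44) | ContainsHexads (permCode σ C)} =
      {σ | permCode σ C = std} ∪ (· * leftPerm swapPerm) '' {σ | permCode σ C = std} := by
    ext σ
    simp only [Set.mem_ofPred_eq, Set.mem_union, Set.mem_image]
    constructor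
    · intro hσ
      obtain ⟨c, hc, h⟩ := hσ.eq_stdCode hC.selfDual.permCode fun v hv => by
        have h₁ := hC.wt_cases _ (mem_permCode.1 hv)
        rw [wt_comp] at h₁
        omega
      simp only [glues, List.mem_cons, List.not_mem_nil, or_false] at hc
      rcases hc with rfl | rfl
      · exact Or.inl h
      · refine Or.inr ⟨σ * leftPerm swapPerm, ?_, ?_⟩
        · rw [← permCode_permCode, h, ← swap_stdCode, permCode_permCode,
            leftPerm_swapPerm_mul_self, permCode_one]
        · rw [mul_assoc, leftPerm_swapPerm_mul_self, mul_one]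
    · rintro (h | ⟨τ, h, rfl⟩)
      · rw [h]
        exact containsHexads_stdCode (by decide)
      · rw [← permCode_permCode, h, swap_stdCode]
        exact containsHexads_stdCode (by decide)
  have hdisj : Disjoint {σ | permCode σ C = std}
      ((· * leftPerm swapPerm) '' {σ | permCode σ C = std}) := by
    refine Set.disjoint_left.2 ?_
    rintro _ h ⟨τ, hτ, rfl⟩
    refine stdCode_ne_std ?_
    rw [← swap_stdCode, ← hτ.out, permCode_permCode]
    exact h.out.trans hτ.out.symm
  rw [hunion, Set.ncard_union_eq hdisj,
    Set.ncard_image_of_injective _ (mul_left_injective _)] at h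
  have hn : {σ : Equiv.Perm (Fin 44) | permCode σ C = std}.ncard = 786839961600 := by omega
  exact hn

lemma HexadCode.exists_permCode (hC : HexadCode C) : ∃ σ, permCode σ C = std := by
  have h : 0 < Nat.card {σ : Equiv.Perm (Fin 44) // permCode σ C = std} := by
    rw [hC.card_isomorphism]
    decide
  obtain ⟨⟨σ, hσ⟩⟩ := (Nat.card_pos_iff.1 h).1
  exact ⟨σ, hσ⟩

lemma HexadCode.card_automorphism (hC : HexadCode C) :
    Nat.card {σ : Equiv.Perm (Fin 44) // permCode σ C = C} = 786839961600 := by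
  obtain ⟨τ, hτ⟩ := hC.exists_permCode
  rw [← hC.card_isomorphism]
  refine Nat.card_congr ((Equiv.mulRight τ).subtypeEquiv fun σ => ?_)
  rw [Equiv.coe_mulRight, ← permCode_permCode, permCode_eq_iff (σ := τ), ← permCode_eq_iff.1 hτ]

lemma HexadCode.codeEquiv {D : Submodule (ZMod 2) (Fin 44 → ZMod 2)} (hC : HexadCode C)
    (hD : HexadCode D) : codeEquiv C D := by
  obtain ⟨σ, hσ⟩ := hC.exists_permCode
  obtain ⟨τ, hτ⟩ := hD.exists_permCode
  exact ⟨σ * τ⁻¹, by rw [← permCode_permCode, hσ, permCode_eq_iff.1 hτ]⟩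

end Isomorphisms

section Target

variable {C : Submodule (ZMod 2) (Fin 44 → ZMod 2)}

lemma card_wt_eq (w : ℕ) : Nat.card {v : Fin 44 → ZMod 2 // v ∈ C ∧ wt v = w} =
    weightCount (C : Set (Fin 44 → ZMod 2)) w :=
  weightCount_eq_ncard.symm

lemma targetCode.hexadCode (h : targetCode C) : HexadCode C := by
  obtain ⟨hC, hk, ⟨hmin, -⟩, -, h8, h10⟩ := h
  rw [card_wt_eq] at h8 h10
  have hlow : ∀ v ∈ C, wt v = 0 ∨ 8 ≤ wt v := fun v hv => by
    by_cases h0 : v = 0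
    · exact Or.inl (by rw [h0, wt_zero])
    · exact Or.inr (hmin v hv h0)
  have hsmall : ∀ w, 0 < w → w < 8 → weightCount (C : Set (Fin 44 → ZMod 2)) w = 0 :=
    fun w h₁ h₂ => weightCount_eq_zero.2 fun v hv => by
      have := hlow v hv
      omega
  obtain ⟨hs₁, hs₂⟩ := hC.shadow_weightCount hk (hsmall 2 (by omega) (by omega))
    (hsmall 4 (by omega) (by omega)) (hsmall 6 (by omega) (by omega)) h10
  refine ⟨hC, fun v hv => ?_, by omega⟩
  have h₁ := hlow v hv
  have h₂ := weightCount_eq_zero.1 h10 v hv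
  obtain ⟨k, hk⟩ := hC.even_wt hv
  omega

lemma targetCode_std : targetCode std := by
  have hz : ∀ w, w ≠ 0 → w ≠ 8 → w < 12 → weightCount (std : Set (Fin 44 → ZMod 2)) w = 0 :=
    fun w h₁ h₂ h₃ => weightCount_eq_zero.2 fun v hv => by
      have := wt_of_mem_std hv
      omega
  have hk := (stdCode_isSelfDual_and_finrank (c := (1327175, 1327175)) (by decide)).2
  have h10 := hz 10 (by decide) (by decide) (by decide)
  have h8 := (std_isSelfDual.shadow_weightCount hk (hz 2 (by decide) (by decide) (by decide))
    (hz 4 (by decide) (by decide) (by decide)) (hz 6 (by decide) (by decide) (by decide)) h10).1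
  rw [weightCount_shadow_std] at h8
  have h8' : weightCount (std : Set (Fin 44 → ZMod 2)) 8 = 660 := by omega
  refine ⟨std_isSelfDual, hk, ⟨fun v hv h0 => ?_, ?_⟩, ⟨3, Nat.prime_three, by decide, _,
    rot_stdCode, orderOf_leftPerm_rotPerm⟩, (card_wt_eq 8).trans h8', (card_wt_eq 10).trans h10⟩
  · have h₁ := wt_of_mem_std hv
    have h₂ := wt_pos h0
    omega
  · have hne : ¬ ∀ v ∈ std, wt v ≠ 8 := fun h => by
      have : weightCount (std : Set (Fin 44 → ZMod 2)) 8 = 0 := weightCount_eq_zero.2 h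
      omega
    push Not at hne
    obtain ⟨v, hv, hv8⟩ := hne
    refine ⟨v, hv, ?_, hv8⟩
    rintro rfl
    rw [wt_zero] at hv8
    omega

end Target

end Proof

/-- Up to equivalence there is a unique such code, and its automorphism group has
order 786839961600. -/
theorem sd44_beta_154_unique :
    (∃ Code : Submodule (ZMod 2) (Fin 44 → ZMod 2), targetCode Code) ∧
    (∀ C₁ C₂ : Submodule (ZMod 2) (Fin 44 → ZMod 2),
      targetCode C₁ → targetCode C₂ → codeEquiv C₁ C₂) ∧
    (∀ Code : Submodule (ZMod 2) (Fin 44 → ZMod 2), targetCode Code →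
      Nat.card {σ : Equiv.Perm (Fin 44) // permCode σ Code = Code} = 786839961600) := by
  exact ⟨⟨std, targetCode_std⟩, fun _ _ h₁ h₂ => h₁.hexadCode.codeEquiv h₂.hexadCode,
    fun _ h => h.hexadCode.card_automorphism⟩

end SD
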